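/- Let R be a chain ring. The following conditions are equivalent: (1) for every R-module M of finite Goldie dimension and every prime ideal L of R, the localization M_L has finite Goldie dimension; (2) for every nonzero prime ideal L of R, the pure-injective hull of R/L, as an R/L-module, has finite Malcev rank (equivalently, the total defect d_R(L) is finite). -/

import Mathlib

open DirectSum


universe u v

/-- `gen M ≤ n`: `M` is generated by at most `n` elements. -/
def GenLE (R : Type u) [Semiring R] (M : Type v) [AddCommMonoid M] [Module R M] (n : ℕ) : Prop :=
  ∃ s : Finset M, s.card ≤ n ∧ Submodule.span R (s : Set M) = ⊤

/-- The Malcev rank of `M` is at most `n`: every finitely generated submodule of `M`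
is generated by at most `n` elements. -/
def MalcevRankLE (R : Type u) [Semiring R] (M : Type v) [AddCommMonoid M] [Module R M]
    (n : ℕ) : Prop :=
  ∀ X : Submodule R M, X.FG →
    ∃ s : Finset M, (s : Set M) ⊆ (X : Set M) ∧ s.card ≤ n ∧ Submodule.span R (s : Set M) = X

/-- An indecomposable (nonzero) module. -/
def IsIndecomposable (R : Type u) [Semiring R] (M : Type v) [AddCommMonoid M] [Module R M] :
    Prop :=
  (∃ x : M, x ≠ 0) ∧ ¬∃ A B : Submodule R M, A ≠ ⊥ ∧ B ≠ ⊥ ∧ IsCompl A B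

/-- A uniform module. -/
def IsUniformModule (R : Type u) [Semiring R] (M : Type v) [AddCommMonoid M] [Module R M] :
    Prop :=
  (∃ x : M, x ≠ 0) ∧ ∀ A B : Submodule R M, A ≠ ⊥ → B ≠ ⊥ → A ⊓ B ≠ ⊥

/-- A pure submodule: tensoring with any module preserves injectivity of the inclusion. -/
def IsPureSubmodule (R : Type u) [CommRing R] {M : Type v} [AddCommGroup M] [Module R M]
    (A : Submodule R M) : Prop :=
  ∀ (C : Type (max u v)) [AddCommGroup C] [Module R C],
    Function.Injective (LinearMap.rTensor C A.subtype)

/-- A uniserial module: submodules are totally ordered. -/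
def IsUniserialModule (R : Type u) [Semiring R] (M : Type v) [AddCommMonoid M] [Module R M] :
    Prop :=
  ∀ A B : Submodule R M, A ≤ B ∨ B ≤ A

/-- A polyserial module: it has a pure-composition series with uniserial factors. -/
def IsPolyserial (R : Type u) [CommRing R] (M : Type v) [AddCommGroup M] [Module R M] : Prop :=
  ∃ (n : ℕ) (F : Fin (n + 1) → Submodule R M),
    F 0 = ⊥ ∧ F (Fin.last n) = ⊤ ∧ StrictMono F ∧
    (∀ i, IsPureSubmodule R (F i)) ∧
    ∀ i : Fin n,
      IsUniserialModule R (↥(F i.succ) ⧸ Submodule.comap (F i.succ).subtype (F i.castSucc))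

/-- A pure-injective module. -/
def IsPureInjective (R : Type u) [CommRing R] (F : Type v) [AddCommGroup F] [Module R F] :
    Prop :=
  ∀ (B : Type (max u v)) [AddCommGroup B] [Module R B] (A : Submodule R B),
    IsPureSubmodule R A → ∀ f : A →ₗ[R] F, ∃ g : B →ₗ[R] F, ∀ a : A, g a = f a

/-- `B` is a pure-essential extension of its submodule `A`. -/
def IsPureEssentialExtension (R : Type u) [CommRing R] {B : Type v} [AddCommGroup B]
    [Module R B] (A : Submodule R B) : Prop :=
  IsPureSubmodule R A ∧
  ∀ K : Submodule R B, K ⊓ A = ⊥ → IsPureSubmodule R (A.map K.mkQ) → K = ⊥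

/-- A maximal ring: every finitely solvable family of congruences is solvable. -/
def IsMaximalCR (R : Type u) [CommRing R] : Prop :=
  ∀ (ι : Type u) (a : ι → R) (A : ι → Ideal R),
    (∀ s : Finset ι, ∃ x : R, ∀ i ∈ s, x - a i ∈ A i) → ∃ x : R, ∀ i, x - a i ∈ A i

/-- An almost maximal ring. -/
def IsAlmostMaximalCR (R : Type u) [CommRing R] : Prop :=
  ∀ (ι : Type u) (a : ι → R) (A : ι → Ideal R), (⨅ i, A i) ≠ ⊥ →
    (∀ s : Finset ι, ∃ x : R, ∀ i ∈ s, x - a i ∈ A i) → ∃ x : R, ∀ i, x - a i ∈ A i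

/-- `M_♯`, the bottom prime ideal associated with `M`, as a set. -/
def sharpSet (R : Type u) [CommRing R] (M : Type v) [AddCommGroup M] [Module R M] : Set R :=
  {s : R | ∃ x : M, x ≠ 0 ∧ s • x = 0}

/-- The set of zero-divisors of `R`. -/
def zeroDivisorsSet (R : Type u) [CommRing R] : Set R :=
  {r : R | ∃ s : R, s ≠ 0 ∧ r * s = 0}

/-- Finite Goldie dimension: every independent family of nonzero submodules is finite. -/
def HasFiniteGoldieDimension (R : Type u) [Semiring R] (M : Type v) [AddCommMonoid M]
    [Module R M] : Prop :=
  ∀ (ι : Type v) (f : ι → Submodule R M), (∀ i, f i ≠ ⊥) →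
    (∀ i, f i ⊓ (⨆ j : {j : ι // j ≠ i}, f j.1) = ⊥) → Finite ι

/-- A superfluous (small) submodule. -/
def IsSuperfluous {R : Type u} [Semiring R] {M : Type v} [AddCommMonoid M] [Module R M]
    (K : Submodule R M) : Prop :=
  ∀ G : Submodule R M, K ⊔ G = ⊤ → G = ⊤

/-- A co-uniform (hollow) module. -/
def IsCouniform (R : Type u) [Semiring R] (M : Type v) [AddCommMonoid M] [Module R M] : Prop :=
  (∃ x : M, x ≠ 0) ∧ ∀ K : Submodule R M, K ≠ ⊤ → IsSuperfluous K

/-- An essential submodule. -/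
def IsEssentialSubmodule {R : Type u} [Semiring R] {M : Type v} [AddCommMonoid M] [Module R M]
    (A : Submodule R M) : Prop :=
  ∀ K : Submodule R M, K ⊓ A = ⊥ → K = ⊥

/-- `M` has dual Goldie dimension `n`. -/
def HasDualGoldieDim (R : Type u) [Ring R] (M : Type v) [AddCommGroup M] [Module R M]
    (n : ℕ) : Prop :=
  ∃ (N : Fin n → Type v) (hab : ∀ i, AddCommGroup (N i)),
    letI := hab
    ∃ hmod : ∀ i, Module R (N i),
      letI := hmod
      ∃ φ : M →ₗ[R] ⨁ i, N i,
        Function.Surjective φ ∧ IsSuperfluous (LinearMap.ker φ) ∧ ∀ i, IsCouniform R (N i)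


section ZornSubmodule

variable {R M : Type*} [Ring R] [AddCommGroup M] [Module R M]

/-- Zorn's lemma for a property of submodules that passes to unions of nonempty chains. -/
theorem exists_ge_maximal_submodule (P : Submodule R M → Prop)
    (hP : ∀ c : Set (Submodule R M), c.Nonempty → (∀ N ∈ c, P N) →
      (∀ x, x ∈ sSup c ↔ ∃ N ∈ c, x ∈ N) → IsChain (· ≤ ·) c → P (sSup c))
    (N₀ : Submodule R M) (h₀ : P N₀) :
    ∃ N, N₀ ≤ N ∧ P N ∧ ∀ N', N ≤ N' → P N' → N' = N := by
  obtain ⟨m, hm, hmax⟩ := zorn_le_nonempty₀ {N | P N} (fun c hcs hc y hy => by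
    refine ⟨sSup c, hP c ⟨y, hy⟩ hcs (fun x => ?_) hc, fun z hz => le_sSup hz⟩
    exact Submodule.mem_sSup_of_directed ⟨y, hy⟩ hc.directedOn) N₀ h₀
  exact ⟨m, hm, hmax.prop, fun N' hle hN' => le_antisymm (hmax.le_of_ge hN' hle) hle⟩

end ZornSubmodule

section RelativeDivisibility

variable {D : Type*} [CommRing D]
  {A N B C : Type*} [AddCommGroup A] [Module D A] [AddCommGroup N] [Module D N]
  [AddCommGroup B] [Module D B] [AddCommGroup C] [Module D C]

/-- A linear map reflects divisibility by scalars; the case of the scalar `0` is injectivity. -/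
def ReflectsDvd (f : A →ₗ[D] B) : Prop :=
  ∀ (x : A) (a : D) (y : B), f x = a • y → ∃ z, x = a • z

/-- Every nonzero element of `B` is the obstruction to some map out of `B` reflecting divisibility
on `A`. -/
def DvdEssential (f : A →ₗ[D] B) : Prop :=
  ∀ h : B, h ≠ 0 → ∃ (x : A) (b a : D) (g : B), f x - b • h = a • g ∧ ¬∃ z, x = a • z

/-- A module without torsion in the elementary sense. -/
def NoTorsion (D : Type*) [CommRing D] (B : Type*) [AddCommGroup B] [Module D B] : Prop :=
  ∀ (a : D) (y : B), a • y = 0 → a = 0 ∨ y = 0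

theorem ReflectsDvd.injective {f : A →ₗ[D] B} (hf : ReflectsDvd f) : Function.Injective f := by
  refine (injective_iff_map_eq_zero f).2 fun x hx => ?_
  obtain ⟨z, hz⟩ := hf x 0 0 (by simpa using hx)
  simpa using hz

theorem NoTorsion.of_injective {f : A →ₗ[D] B} (hf : Function.Injective f)
    (hB : NoTorsion D B) : NoTorsion D A := by
  intro a y h
  refine (hB a (f y) (by rw [← map_smul, h, map_zero])).imp_right fun h => hf (by simpa using h)

theorem ReflectsDvd.comp {f : A →ₗ[D] N} {g : N →ₗ[D] B} (hf : ReflectsDvd f)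
    (hg : ReflectsDvd g) : ReflectsDvd (g ∘ₗ f) := by
  intro x a y h
  obtain ⟨z, hz⟩ := hg (f x) a y h
  exact hf x a z hz

theorem ReflectsDvd.of_comp {f : A →ₗ[D] N} {g : N →ₗ[D] B} (h : ReflectsDvd (g ∘ₗ f)) :
    ReflectsDvd f := by
  intro x a y hx
  exact h x a (g y) (by simp [hx])

/-- Over a chain domain, a map reflecting divisibility on an essential submodule reflects it. -/
theorem DvdEssential.reflectsDvd_of_comp (hD : ∀ a b : D, a ∣ b ∨ b ∣ a) {f : A →ₗ[D] N}
    {g : N →ₗ[D] C} (hf : DvdEssential f) (hN : NoTorsion D N) (h : ReflectsDvd (g ∘ₗ f)) :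
    ReflectsDvd g := by
  intro x a c hx
  by_contra hxa
  have hx0 : x ≠ 0 := fun h => hxa ⟨0, by simp [h]⟩
  obtain ⟨y, b, a₁, n, hy, hya⟩ := hf x hx0
  have hb : b ≠ 0 := by
    rintro rfl
    exact hya (h.of_comp y a₁ n (by simpa using hy))
  have hgy : g (f y) = (b * a) • c + a₁ • g n := by
    have := congrArg g hy
    rw [map_sub, map_smul, map_smul, hx, sub_eq_iff_eq_add] at this
    rw [this, mul_smul, add_comm]
  rcases hD a₁ (b * a) with ⟨m, hm⟩ | ⟨m, hm⟩
  · exact hya (h y a₁ (m • c + g n) (by simp [hgy, hm, mul_smul]))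
  · obtain ⟨y', hy'⟩ := h y (b * a) (c + m • g n) (by simp [hgy, hm, mul_smul])
    have h0 : b • (a • f y' - x - (a * m) • n) = 0 := by
      rw [hy', hm] at hy
      rw [smul_sub, smul_sub, smul_smul, smul_smul, ← mul_assoc, ← hy, map_smul]
      abel
    rcases hN _ _ h0 with h0 | h0
    · exact hb h0
    · refine hxa ⟨f y' - m • n, ?_⟩
      rw [smul_sub, smul_smul]
      exact (sub_eq_zero.1 (by rw [← h0]; abel)).symm

/-- Essentiality is transitive over a chain domain. -/
theorem DvdEssential.comp (hD : ∀ a b : D, a ∣ b ∨ b ∣ a) {f : A →ₗ[D] N} {g : N →ₗ[D] B}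
    (hf : DvdEssential f) (hg : DvdEssential g) (hfr : ReflectsDvd f)
    (hN : NoTorsion D N) : DvdEssential (g ∘ₗ f) := by
  intro h hh
  obtain ⟨x, b, a, y, hxy, hxa⟩ := hg h hh
  have hx0 : x ≠ 0 := fun h => hxa ⟨0, by simp [h]⟩
  obtain ⟨z, b₁, a₁, n, hzn, hza⟩ := hf x hx0
  have hb : b₁ ≠ 0 := by
    rintro rfl
    exact hza (hfr z a₁ n (by simpa using hzn))
  have key : g (f z) - (b₁ * b) • h = (b₁ * a) • y + a₁ • g n := by
    have h1 := congrArg g hzn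
    rw [map_sub, map_smul, map_smul, sub_eq_iff_eq_add] at h1
    rw [sub_eq_iff_eq_add] at hxy
    rw [h1, hxy, smul_add, smul_smul, smul_smul]
    abel
  rcases hD a₁ (b₁ * a) with ⟨m, hm⟩ | ⟨m, hm⟩
  · exact ⟨z, b₁ * b, a₁, m • y + g n, by
      rw [LinearMap.comp_apply, key, hm]; simp only [mul_smul, smul_add], hza⟩
  · refine ⟨z, b₁ * b, b₁ * a, y + m • g n, by
      rw [LinearMap.comp_apply, key, hm]; simp only [mul_smul, smul_add], ?_⟩
    rintro ⟨z', hz'⟩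
    have h0 : b₁ • (a • f z' - x - (a * m) • n) = 0 := by
      rw [hz', hm] at hzn
      rw [smul_sub, smul_sub, smul_smul, smul_smul, ← mul_assoc, ← hzn, map_smul]
      abel
    rcases hN _ _ h0 with h0 | h0
    · exact hb h0
    · refine hxa ⟨f z' - m • n, ?_⟩
      rw [smul_sub, smul_smul]
      exact (sub_eq_zero.1 (by rw [← h0]; abel)).symm

theorem NoTorsion.of_dvdEssential {f : A →ₗ[D] B} (hf : ReflectsDvd f) (hess : DvdEssential f)
    (hA : NoTorsion D A) : NoTorsion D B := by
  intro c h hch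
  by_contra! hne
  obtain ⟨x, b, a, g, hx, hxa⟩ := hess h hne.2
  obtain ⟨z, hz⟩ := hf (c • x) (c * a) g (by
    rw [sub_eq_iff_eq_add] at hx
    rw [map_smul, hx, smul_add, smul_comm c b h, hch, smul_zero, add_zero, smul_smul])
  have : c • (x - a • z) = 0 := by rw [smul_sub, hz, smul_smul, sub_self]
  rcases hA _ _ this with h | h
  · exact hne.1 h
  · exact hxa ⟨z, sub_eq_zero.1 h⟩

/-- A map reflecting divisibility becomes essential modulo a suitable submodule. -/
theorem exists_quotient_dvdEssential {f : A →ₗ[D] B} (hf : ReflectsDvd f) :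
    ∃ K : Submodule D B, ReflectsDvd (K.mkQ ∘ₗ f) ∧ DvdEssential (K.mkQ ∘ₗ f) := by
  have hiff : ∀ K : Submodule D B, ReflectsDvd (K.mkQ ∘ₗ f) ↔
      ∀ (x : A) (a : D) (y : B), f x - a • y ∈ K → ∃ z, x = a • z := by
    intro K
    constructor
    · intro h x a y hxy
      refine h x a (K.mkQ y) ?_
      rwa [LinearMap.comp_apply, ← map_smul, ← sub_eq_zero, ← map_sub, Submodule.mkQ_apply,
        Submodule.Quotient.mk_eq_zero]
    · intro h x a y hxy
      obtain ⟨y, rfl⟩ := K.mkQ_surjective y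
      refine h x a y ?_
      rwa [LinearMap.comp_apply, ← map_smul, ← sub_eq_zero, ← map_sub, Submodule.mkQ_apply,
        Submodule.Quotient.mk_eq_zero] at hxy
  obtain ⟨K, -, hK, hmax⟩ := exists_ge_maximal_submodule
    (fun K : Submodule D B => ∀ (x : A) (a : D) (y : B), f x - a • y ∈ K → ∃ z, x = a • z)
    (fun c _ hc hmem _ x a y hxy => by
      obtain ⟨N, hN, hxN⟩ := (hmem _).1 hxy
      exact hc N hN x a y hxN) ⊥
    (fun x a y hxy => hf x a y (sub_eq_zero.1 (by simpa using hxy)))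
  refine ⟨K, (hiff K).2 hK, fun h hh => ?_⟩
  obtain ⟨h, rfl⟩ := K.mkQ_surjective h
  by_contra! hcon
  have hsup : K ⊔ Submodule.span D {h} = K := by
    refine hmax _ le_sup_left fun x a y hxy => ?_
    obtain ⟨k, hk, w, hw, hkw⟩ := Submodule.mem_sup.1 hxy
    obtain ⟨b, rfl⟩ := Submodule.mem_span_singleton.1 hw
    refine hcon x b a (K.mkQ y) ?_
    rw [LinearMap.comp_apply, ← map_smul, ← map_smul, ← map_sub, ← sub_eq_zero, ← map_sub]
    have : f x - b • h - a • y = k := by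
      rw [sub_right_comm, ← hkw, add_sub_cancel_right]
    rwa [this, Submodule.mkQ_apply, Submodule.Quotient.mk_eq_zero]
  apply hh
  have : h ∈ K := hsup ▸ Submodule.mem_sup_right (Submodule.mem_span_singleton_self h)
  simpa using this

end RelativeDivisibility

section Purity

variable {D : Type u} [CommRing D] {A B : Type u} [AddCommGroup A] [Module D A]
  [AddCommGroup B] [Module D B]

/-- The inclusion of a pure submodule reflects divisibility. -/
theorem IsPureSubmodule.reflectsDvd {S : Submodule D B} (hS : IsPureSubmodule D S) :
    ReflectsDvd S.subtype := by
  intro x a y hxy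
  have h := hS (D ⧸ Ideal.span {a})
  have ha : ∀ {M : Type u} [AddCommGroup M] [Module D M] (m : M),
      (a • m) ⊗ₜ[D] (Ideal.Quotient.mk (Ideal.span {a}) 1) = 0 := by
    intro M _ _ m
    rw [TensorProduct.smul_tmul]
    have : a • Ideal.Quotient.mk (Ideal.span {a}) 1 = 0 := by
      rw [← Ideal.Quotient.mk_eq_mk, ← Submodule.Quotient.mk_smul, Ideal.Quotient.mk_eq_mk,
        Ideal.Quotient.eq_zero_iff_mem]
      simp
    rw [this, TensorProduct.tmul_zero]
  have h0 : x ⊗ₜ[D] (Ideal.Quotient.mk (Ideal.span {a}) 1) = 0 := by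
    apply h
    rw [LinearMap.rTensor_tmul, hxy, ha, map_zero]
  have h1 := congrArg (TensorProduct.tensorQuotEquivQuotSMul S (Ideal.span {a})) h0
  rw [map_zero, TensorProduct.tensorQuotEquivQuotSMul_tmul_mk, one_smul,
    Submodule.Quotient.mk_eq_zero, Submodule.ideal_span_singleton_smul] at h1
  obtain ⟨z, -, hz⟩ := h1
  exact ⟨z, hz.symm⟩

/-- Over a chain domain, the range of a map to a torsion-free module that reflects divisibility
is pure. -/
theorem ReflectsDvd.isPureSubmodule_range [IsDomain D] [ValuationRing D] {f : A →ₗ[D] B}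
    (hf : ReflectsDvd f) (hB : NoTorsion D B) : IsPureSubmodule D (LinearMap.range f) := by
  intro C _ _
  have hflat : Module.Flat D (B ⧸ LinearMap.range f) := by
    rw [Module.Flat.flat_iff_torsion_eq_bot_of_isBezout,
      ← Submodule.isTorsionFree_iff_torsion_eq_bot]
    refine Module.IsTorsionFree.of_smul_eq_zero fun a y hay => ?_
    obtain ⟨y, rfl⟩ := Submodule.mkQ_surjective _ y
    rw [← map_smul, Submodule.mkQ_apply, Submodule.Quotient.mk_eq_zero] at hay
    obtain ⟨x, hx⟩ := hay
    obtain ⟨z, rfl⟩ := hf x a y hx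
    have : a • (y - f z) = 0 := by rw [smul_sub, ← hx, map_smul, sub_self]
    refine (hB a _ this).imp_right fun h => ?_
    rw [Submodule.mkQ_apply, Submodule.Quotient.mk_eq_zero]
    exact ⟨z, (sub_eq_zero.1 h).symm⟩
  rw [← LinearMap.lTensor_inj_iff_rTensor_inj]
  exact LinearMap.lTensor_injective_of_exact_of_flat (LinearMap.range f).mkQ
    (Submodule.mkQ_surjective _) _ (Submodule.injective_subtype _)
    (LinearMap.exact_subtype_mkQ _) C

theorem isPureInjective_characterModule : IsPureInjective D (CharacterModule A) := by
  intro B _ _ S hS f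
  obtain ⟨g, hg⟩ := rTensor_injective_iff_lcomp_surjective.1 (hS A) f
  exact ⟨g, fun a => DFunLike.congr_fun hg a⟩

/-- Evaluation into the double character module. -/
def evalCharacter (D A : Type u) [CommRing D] [AddCommGroup A] [Module D A] :
    A →ₗ[D] CharacterModule (CharacterModule A) where
  toFun a := AddMonoidHom.eval a
  map_add' a b := by ext χ; exact map_add (χ : CharacterModule A) a b
  map_smul' r a := by ext; rfl

theorem reflectsDvd_evalCharacter : ReflectsDvd (evalCharacter D A) := by
  intro x a φ h
  by_contra hx
  have hne : (LinearMap.range (LinearMap.lsmul D A a)).mkQ x ≠ 0 := by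
    rw [Submodule.mkQ_apply, Ne, Submodule.Quotient.mk_eq_zero]
    rintro ⟨z, hz⟩
    exact hx ⟨z, hz.symm⟩
  obtain ⟨χ, hχ⟩ := CharacterModule.exists_character_apply_ne_zero_of_ne_zero hne
  set ψ : CharacterModule A := CharacterModule.dual (LinearMap.range (LinearMap.lsmul D A a)).mkQ χ
  have hψ : a • ψ = 0 := by
    ext m
    have : (LinearMap.range (LinearMap.lsmul D A a)).mkQ (a • m) = 0 := by
      rw [Submodule.mkQ_apply, Submodule.Quotient.mk_eq_zero]
      exact ⟨m, rfl⟩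
    change χ ((LinearMap.range (LinearMap.lsmul D A a)).mkQ (a • m)) = 0
    rw [this, map_zero]
  have := DFunLike.congr_fun h ψ
  rw [CharacterModule.smul_apply, hψ, map_zero] at this
  exact hχ this

theorem noTorsion_characterModule_characterModule (hA : NoTorsion D A) :
    NoTorsion D (CharacterModule (CharacterModule A)) := by
  intro a φ h
  by_cases ha : a = 0
  · exact Or.inl ha
  right
  ext χ
  have hinj : Function.Injective (LinearMap.lsmul D A a) :=
    (injective_iff_map_eq_zero _).2 fun x hx => (hA a x hx).resolve_left ha
  obtain ⟨ψ, rfl⟩ := CharacterModule.dual_surjective_of_injective _ hinj χ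
  exact DFunLike.congr_fun h ψ

/-- A torsion-free module over a chain domain reflecting divisibility in a torsion-free
pure-injective module has a torsion-free pure-injective essential extension. -/
theorem exists_isPureInjective_dvdEssential [IsDomain D] [ValuationRing D] {G : Type u}
    [AddCommGroup G] [Module D G] (hG : NoTorsion D G) (hGI : IsPureInjective D G)
    {f : A →ₗ[D] G} (hf : ReflectsDvd f) :
    ∃ (N : Submodule D G) (j : A →ₗ[D] N), N.subtype ∘ₗ j = f ∧ DvdEssential j ∧
      IsPureInjective D N := by
  have hD : ∀ a b : D, a ∣ b ∨ b ∣ a := ValuationRing.dvd_total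
  obtain ⟨N, hfN, hN, hmax⟩ := exists_ge_maximal_submodule
    (fun N : Submodule D G => LinearMap.range f ≤ N ∧ ∀ h ∈ N, h ≠ 0 →
      ∃ (x : A) (b a : D), ∃ g ∈ N, f x - b • h = a • g ∧ ¬∃ z, x = a • z)
    (fun c hne hc hmem _ => by
      obtain ⟨N₀, hN₀⟩ := hne
      refine ⟨(hc N₀ hN₀).1.trans (le_sSup hN₀), fun h hh h0 => ?_⟩
      obtain ⟨N, hN, hhN⟩ := (hmem _).1 hh
      obtain ⟨x, b, a, g, hg, h1⟩ := (hc N hN).2 h hhN h0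
      exact ⟨x, b, a, g, (hmem _).2 ⟨N, hN, hg⟩, h1⟩) (LinearMap.range f)
    ⟨le_rfl, by
      rintro _ ⟨x, rfl⟩ h0
      refine ⟨x, 1, 0, 0, zero_mem _, by simp, ?_⟩
      rintro ⟨z, rfl⟩
      simp at h0⟩
  let j : A →ₗ[D] N := f.codRestrict N fun x => hfN ⟨x, rfl⟩
  have hj : N.subtype ∘ₗ j = f := rfl
  have hjess : DvdEssential j := by
    intro h hh
    obtain ⟨x, b, a, g, hg, h1, h2⟩ := hN.2 h h.2 (by simpa using hh)
    exact ⟨x, b, a, ⟨g, hg⟩, Subtype.ext h1, h2⟩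
  have hNT : NoTorsion D N := hG.of_injective N.injective_subtype
  have hNr : ReflectsDvd N.subtype := hjess.reflectsDvd_of_comp hD hNT hf
  have hjr : ReflectsDvd j := ReflectsDvd.of_comp (g := N.subtype) hf
  obtain ⟨K, hKr, hKess⟩ := exists_quotient_dvdEssential hNr
  have hBT : NoTorsion D (G ⧸ K) := NoTorsion.of_dvdEssential hKr hKess hNT
  set p := K.mkQ ∘ₗ N.subtype
  obtain ⟨g, hg⟩ := hGI _ _ (hKr.isPureSubmodule_range hBT)
    (N.subtype ∘ₗ (LinearEquiv.ofInjective p hKr.injective).symm.toLinearMap)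
  have hgp : g ∘ₗ p = N.subtype := by
    ext n
    have := hg (LinearEquiv.ofInjective p hKr.injective n)
    simpa using this
  have hpj : DvdEssential (p ∘ₗ j) := hjess.comp hD hKess hjr hNT
  have hgr : ReflectsDvd g := by
    refine hKess.reflectsDvd_of_comp hD hBT ?_
    rw [hgp]
    exact hNr
  have hrange : LinearMap.range g = N := by
    refine hmax _ ?_ ⟨?_, ?_⟩
    · intro n hn
      exact ⟨p ⟨n, hn⟩, LinearMap.congr_fun hgp ⟨n, hn⟩⟩
    · rintro _ ⟨x, rfl⟩
      exact ⟨p (j x), LinearMap.congr_fun hgp (j x)⟩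
    · rintro _ ⟨y, rfl⟩ hy
      obtain ⟨x, b, a, z, h1, h2⟩ := hpj y (by rintro rfl; simp at hy)
      refine ⟨x, b, a, g z, ⟨z, rfl⟩, ?_, h2⟩
      rw [← map_smul g a, ← h1, map_sub, map_smul]
      congr 1
      exact (LinearMap.congr_fun hgp (j x)).symm
  refine ⟨N, j, hj, hjess, ?_⟩
  intro B _ _ S hS φ
  obtain ⟨ψ, hψ⟩ := hGI B S hS (N.subtype ∘ₗ φ)
  let r : G →ₗ[D] N := (g ∘ₗ K.mkQ).codRestrict N fun x => hrange ▸ ⟨_, rfl⟩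
  refine ⟨r ∘ₗ ψ, fun a => ?_⟩
  apply Subtype.ext
  change g (K.mkQ (ψ a)) = φ a
  rw [hψ]
  exact LinearMap.congr_fun hgp (φ a)

/-- Divisibility-essential extensions are pure-essential. -/
theorem DvdEssential.isPureEssentialExtension [IsDomain D] [ValuationRing D] {f : A →ₗ[D] B}
    (hf : ReflectsDvd f) (hess : DvdEssential f) (hB : NoTorsion D B) :
    IsPureEssentialExtension D (LinearMap.range f) := by
  refine ⟨hf.isPureSubmodule_range hB, fun K hK hpure => ?_⟩
  have hinj : Function.Injective (K.mkQ ∘ₗ f) := by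
    refine (injective_iff_map_eq_zero _).2 fun x hx => ?_
    have : f x ∈ K ⊓ LinearMap.range f := ⟨by simpa using hx, x, rfl⟩
    rw [hK, Submodule.mem_bot] at this
    exact hf.injective (by simpa using this)
  have hr : ReflectsDvd (K.mkQ ∘ₗ f) := by
    intro x a y hxy
    obtain ⟨⟨_, _, ⟨z, rfl⟩, rfl⟩, hz⟩ :=
      hpure.reflectsDvd ⟨K.mkQ (f x), f x, ⟨x, rfl⟩, rfl⟩ a y hxy
    refine ⟨z, hinj ?_⟩
    rw [map_smul]
    exact congrArg Subtype.val hz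
  have := (hess.reflectsDvd_of_comp ValuationRing.dvd_total hB hr).injective
  rw [← LinearMap.ker_eq_bot, Submodule.ker_mkQ] at this
  exact this

/-- A torsion-free module over a chain domain embeds in a pure-injective essential extension. -/
theorem exists_pureInjectiveHull [IsDomain D] [ValuationRing D] (hA : NoTorsion D A) :
    ∃ (H : Type u) (_ : AddCommGroup H) (_ : Module D H) (j : A →ₗ[D] H),
      IsPureInjective D H ∧ NoTorsion D H ∧ ReflectsDvd j ∧ DvdEssential j := by
  have hT := noTorsion_characterModule_characterModule hA
  obtain ⟨N, j, hj, hjess, hN⟩ := exists_isPureInjective_dvdEssential hT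
    isPureInjective_characterModule (reflectsDvd_evalCharacter (D := D) (A := A))
  refine ⟨N, inferInstance, inferInstance, j, hN, hT.of_injective N.injective_subtype, ?_, hjess⟩
  apply ReflectsDvd.of_comp (g := N.subtype)
  rw [hj]
  exact reflectsDvd_evalCharacter

/-- A pure-essential extension of a torsion-free module over a chain domain is
divisibility-essential. -/
theorem IsPureEssentialExtension.dvdEssential [IsDomain D] [ValuationRing D] {f : A →ₗ[D] B}
    (hA : NoTorsion D A) (hf : Function.Injective f)
    (h : IsPureEssentialExtension D (LinearMap.range f)) :
    ReflectsDvd f ∧ DvdEssential f := by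
  have hr : ReflectsDvd f := by
    intro x a y hxy
    obtain ⟨⟨_, z, rfl⟩, hz⟩ := h.1.reflectsDvd ⟨f x, x, rfl⟩ a y hxy
    refine ⟨z, hf ?_⟩
    rw [map_smul]
    exact congrArg Subtype.val hz
  refine ⟨hr, ?_⟩
  obtain ⟨K, hKr, hKess⟩ := exists_quotient_dvdEssential hr
  have hKT := NoTorsion.of_dvdEssential hKr hKess hA
  have hK : K = ⊥ := by
    refine h.2 K ?_ ?_
    · rw [eq_bot_iff]
      rintro _ ⟨hk, x, rfl⟩
      have : x = 0 := hKr.injective (by simpa using hk)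
      simp [this]
    · rw [← LinearMap.range_comp]
      exact hKr.isPureSubmodule_range hKT
  subst hK
  intro y hy
  obtain ⟨x, b, a, g, h1, h2⟩ := hKess (Submodule.mkQ ⊥ y) (by simpa using hy)
  obtain ⟨g, rfl⟩ := Submodule.mkQ_surjective _ g
  refine ⟨x, b, a, g, ?_, h2⟩
  rw [LinearMap.comp_apply, ← map_smul, ← map_smul, ← map_sub, ← sub_eq_zero, ← map_sub] at h1
  rw [Submodule.mkQ_apply, Submodule.Quotient.mk_eq_zero, Submodule.mem_bot] at h1
  exact sub_eq_zero.1 h1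

end Purity

section ChainRing

variable {R : Type*} [CommRing R]

theorem exists_forall_dvd (hR : ∀ a b : R, a ∣ b ∨ b ∣ a) {ι : Type*} {s : Finset ι}
    (hs : s.Nonempty) (f : ι → R) : ∃ j ∈ s, ∀ i ∈ s, f j ∣ f i := by
  induction hs using Finset.Nonempty.cons_induction with
  | singleton a => exact ⟨a, by simp, by simp⟩
  | cons a s ha hs ih =>
    obtain ⟨j, hj, h⟩ := ih
    rcases hR (f a) (f j) with haj | haj
    · refine ⟨a, by simp, fun i hi => ?_⟩
      rcases Finset.mem_cons.1 hi with rfl | hi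
      · exact dvd_rfl
      · exact haj.trans (h i hi)
    · refine ⟨j, by simp [hj], fun i hi => ?_⟩
      rcases Finset.mem_cons.1 hi with rfl | hi
      · exact haj
      · exact h i hi

theorem Finsupp.exists_eq_smul_of_forall_dvd {ι : Type*} {f : ι →₀ R} {x : R}
    (h : ∀ i, x ∣ f i) : ∃ g : ι →₀ R, f = x • g := by
  classical
  choose g hg using h
  refine ⟨Finsupp.onFinset f.support (fun i => if f i = 0 then 0 else g i) fun i hi => ?_, ?_⟩
  · rw [Finsupp.mem_support_iff]
    intro h0
    simp [h0] at hi
  · ext i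
    by_cases h0 : f i = 0
    · simp [h0]
    · simpa [h0] using hg i

/-- Over a chain ring a nonzero vector is one of its coordinates times a vector having a
coordinate equal to one. -/
theorem Finsupp.exists_eq_smul_and_apply_eq_one (hR : ∀ a b : R, a ∣ b ∨ b ∣ a) {ι : Type*}
    {f : ι →₀ R} (hf : f ≠ 0) : ∃ (j : ι) (g : ι →₀ R), f = f j • g ∧ g j = 1 := by
  classical
  obtain ⟨j, hj, hdvd⟩ := exists_forall_dvd hR (Finsupp.support_nonempty_iff.2 hf) f
  obtain ⟨g, hg⟩ := Finsupp.exists_eq_smul_of_forall_dvd (f := f) (x := f j) fun i => by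
    by_cases hi : f i = 0
    · simp [hi]
    · exact hdvd i (Finsupp.mem_support_iff.2 hi)
  refine ⟨j, g.update j 1, ?_, by simp⟩
  ext i
  by_cases hi : i = j
  · subst hi; simp
  · have := DFunLike.congr_fun hg i
    simpa [hi] using this

theorem Ideal.exists_eq_mul_of_mem (hR : ∀ a b : R, a ∣ b ∨ b ∣ a) {L : Ideal R} (hL : L.IsPrime)
    {s l : R} (hs : s ∉ L) (hl : l ∈ L) : ∃ l' ∈ L, l = s * l' := by
  rcases hR s l with ⟨l', rfl⟩ | h
  · exact ⟨l', (hL.mem_or_mem hl).resolve_left hs, rfl⟩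
  · exact absurd (L.mem_of_dvd h hl) hs

theorem eq_zero_of_eq_smul_of_not_isUnit [IsLocalRing R] {M : Type*} [AddCommGroup M] [Module R M]
    {p : R} (hp : ¬IsUnit p) {y : M} (h : y = p • y) : y = 0 := by
  have hu : IsUnit (1 - p) := (IsLocalRing.isUnit_or_isUnit_one_sub_self p).resolve_left hp
  have : (1 - p) • y = 0 := by rw [sub_smul, one_smul, ← h, sub_self]
  exact hu.smul_eq_zero.1 this

theorem Ideal.IsPrime.not_isUnit_of_mem {L : Ideal R} (hL : L.IsPrime) {p : R} (hp : p ∈ L) :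
    ¬IsUnit p := fun h => hL.ne_top (L.eq_top_of_isUnit_mem hp h)

end ChainRing

section LocalTorsion

variable {R : Type*} [CommRing R] {M : Type*} [AddCommGroup M] [Module R M]

/-- `x` is killed by an element outside of the ideal `L`. -/
def IsTorsionOutside (L : Ideal R) (x : M) : Prop :=
  ∃ s ∉ L, s • x = 0

/-- The images of the `x i` in the localization at `L` are nonzero and generate their direct
sum. -/
def IndepOutside (L : Ideal R) {ι : Type*} (x : ι → M) : Prop :=
  (∀ i, ¬IsTorsionOutside L (x i)) ∧
    ∀ c : ι →₀ R, IsTorsionOutside L (Finsupp.linearCombination R x c) →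
      ∀ i, IsTorsionOutside L (c i • x i)

theorem IsTorsionOutside.zero {L : Ideal R} (hL : L.IsPrime) :
    IsTorsionOutside L (0 : M) :=
  ⟨1, (Ideal.ne_top_iff_one L).1 hL.ne_top, smul_zero _⟩

theorem IsTorsionOutside.smul {L : Ideal R} {x : M} (h : IsTorsionOutside L x) (r : R) :
    IsTorsionOutside L (r • x) := by
  obtain ⟨s, hs, h⟩ := h
  exact ⟨s, hs, by rw [smul_comm, h, smul_zero]⟩

theorem IsTorsionOutside.add {L : Ideal R} (hL : L.IsPrime) {x y : M} (hx : IsTorsionOutside L x)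
    (hy : IsTorsionOutside L y) : IsTorsionOutside L (x + y) := by
  obtain ⟨s, hs, hx⟩ := hx
  obtain ⟨t, ht, hy⟩ := hy
  refine ⟨s * t, fun h => (hL.mem_or_mem h).elim hs ht, ?_⟩
  rw [smul_add, mul_smul, mul_smul, hy, smul_comm, hx, smul_zero, smul_zero, add_zero]

theorem IsTorsionOutside.of_smul {L : Ideal R} (hL : L.IsPrime) {x : M} {r : R} (hr : r ∉ L)
    (h : IsTorsionOutside L (r • x)) : IsTorsionOutside L x := by
  obtain ⟨s, hs, h⟩ := h
  exact ⟨s * r, fun h => (hL.mem_or_mem h).elim hs hr, by rw [mul_smul, h]⟩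

theorem IsTorsionOutside.finset_sum {L : Ideal R} (hL : L.IsPrime) {ι : Type*} {s : Finset ι}
    {x : ι → M} (h : ∀ i ∈ s, IsTorsionOutside L (x i)) : IsTorsionOutside L (∑ i ∈ s, x i) :=
  Finset.sum_induction _ _ (fun _ _ => IsTorsionOutside.add hL) (.zero hL) h

theorem mkLinearMap_eq_zero_iff {L : Ideal R} [L.IsPrime] {x : M} :
    LocalizedModule.mkLinearMap L.primeCompl M x = 0 ↔ IsTorsionOutside L x := by
  rw [IsLocalizedModule.eq_zero_iff L.primeCompl]
  exact ⟨fun ⟨s, hs⟩ => ⟨s, s.2, hs⟩, fun ⟨s, hs, h⟩ => ⟨⟨s, hs⟩, h⟩⟩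

end LocalTorsion

section GoldieDimension

variable {R : Type u} [CommRing R] {M : Type u} [AddCommGroup M] [Module R M]

theorem IndepOutside.finite {L : Ideal R} [hL : L.IsPrime] {ι : Type u} {x : ι → M}
    (hx : IndepOutside L x)
    (h : HasFiniteGoldieDimension (Localization.AtPrime L) (LocalizedModule L.primeCompl M)) :
    Finite ι := by
  classical
  set m := LocalizedModule.mkLinearMap L.primeCompl M with hm
  refine h ι (fun i => Submodule.span _ {m (x i)}) (fun i => ?_) (fun i => ?_)
  · rw [Ne, Submodule.span_singleton_eq_bot, mkLinearMap_eq_zero_iff]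
    exact hx.1 i
  rw [eq_bot_iff]
  rintro v ⟨hv, hv'⟩
  have hv'' : v ∈ Submodule.span (Localization.AtPrime L) (m '' (x '' {j | j ≠ i})) := by
    rw [SetLike.mem_coe, ← Submodule.span_iUnion] at hv'
    convert hv' using 2
    ext w
    simp [eq_comm]
  obtain ⟨s, hs⟩ := multiple_mem_span_of_mem_localization_span L.primeCompl _ _ _ hv
  obtain ⟨t, ht⟩ := multiple_mem_span_of_mem_localization_span L.primeCompl _ _ _ hv''
  obtain ⟨a, ha⟩ := Submodule.mem_span_singleton.1 hs
  rw [← Submodule.map_span] at ht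
  obtain ⟨w, hw, hwt⟩ := ht
  obtain ⟨c, hc, rfl⟩ := (Finsupp.mem_span_image_iff_linearCombination R).1 hw
  have hci : c i = 0 := by
    by_contra h0
    exact (Finsupp.mem_supported R c).1 hc (Finsupp.mem_support_iff.2 h0) rfl
  have hkey : m (Finsupp.linearCombination R x (Finsupp.single i ((t : R) * a) - (s : R) • c))
      = 0 := by
    rw [map_sub, map_sub, map_smul, map_smul, hwt, Finsupp.linearCombination_single, map_smul,
      mul_smul, ha, Submonoid.smul_def, Submonoid.smul_def, smul_comm, sub_self]
  have h1 := hx.2 _ (mkLinearMap_eq_zero_iff.1 hkey) i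
  have h2 : IsTorsionOutside L (a • x i) := by
    refine IsTorsionOutside.of_smul hL (r := t) t.2 ?_
    simpa [hci, mul_smul] using h1
  have h3 := mkLinearMap_eq_zero_iff.2 h2
  rw [← hm, map_smul, ha] at h3
  rw [Submodule.mem_bot]
  exact IsLocalizedModule.smul_injective m s (h3.trans (smul_zero s).symm)

theorem exists_indepOutside_of_not_hasFiniteGoldieDimension {L : Ideal R} [hL : L.IsPrime]
    (h : ¬HasFiniteGoldieDimension (Localization.AtPrime L) (LocalizedModule L.primeCompl M)) :
    ∃ x : ℕ → M, IndepOutside L x := by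
  classical
  unfold HasFiniteGoldieDimension at h
  push Not at h
  obtain ⟨ι, f, hf, hind, hinf⟩ := h
  set m := LocalizedModule.mkLinearMap L.primeCompl M with hm
  have hx : ∀ i, ∃ x : M, m x ∈ f i ∧ m x ≠ 0 := by
    intro i
    obtain ⟨y, hy, hy0⟩ := (Submodule.ne_bot_iff _).1 (hf i)
    obtain ⟨⟨x, s⟩, hxs⟩ := IsLocalizedModule.surj L.primeCompl m y
    refine ⟨x, ?_, ?_⟩
    · rw [← hxs]
      exact Submodule.smul_of_tower_mem _ s hy
    · rw [← hxs]
      exact fun h => hy0 (IsLocalizedModule.smul_injective m s (h.trans (smul_zero s).symm))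
  choose x hxf hx0 using hx
  let e := Infinite.natEmbedding ι
  refine ⟨x ∘ e, fun n h => hx0 _ (mkLinearMap_eq_zero_iff.2 h), fun c hc n => ?_⟩
  have h0 := mkLinearMap_eq_zero_iff.2 hc
  rw [← hm] at h0
  rw [← mkLinearMap_eq_zero_iff, ← hm, ← Submodule.mem_bot (R := Localization.AtPrime L),
    ← hind (e n)]
  refine ⟨?_, ?_⟩
  · rw [map_smul]
    exact Submodule.smul_of_tower_mem _ _ (hxf _)
  have hsplit : c n • (x ∘ e) n = Finsupp.linearCombination R (x ∘ e) c -
      Finsupp.linearCombination R (x ∘ e) (c.erase n) := by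
    rw [← map_sub, ← Finsupp.linearCombination_single]
    congr 1
    rw [eq_sub_iff_add_eq, Finsupp.single_add_erase]
  rw [hsplit, map_sub, h0, zero_sub, SetLike.mem_coe, Submodule.neg_mem_iff,
    Finsupp.linearCombination_apply, Finsupp.sum, map_sum]
  refine Submodule.sum_mem _ fun k hk => ?_
  have hkn : k ≠ n := by
    rintro rfl
    simp at hk
  rw [map_smul]
  refine Submodule.smul_of_tower_mem _ _ ?_
  exact Submodule.mem_iSup_of_mem (p := fun j : {j : ι // j ≠ e n} => f j.1)
    ⟨e k, fun h => hkn (e.injective h)⟩ (hxf _)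

end GoldieDimension

section UniformQuotient

variable {R : Type*} [CommRing R] {L : Ideal R} {H : Type*} [AddCommGroup H] [Module R H]
  {I : Type*} {h : I → H} {i₀ : I} {c : R}

/-- The vectors `u • f` with `c ∣ u * t` for some `t ∉ L` dividing the combination of the `h i`
with coefficients `f` form a submodule. -/
theorem exists_submodule_mem_iff_smul (hR : ∀ a b : R, a ∣ b ∨ b ∣ a) (hL : L.IsPrime)
    (h : I → H) (c : R) :
    ∃ N : Submodule R (I →₀ R), ∀ x, x ∈ N ↔ ∃ u, ∃ t ∉ L, ∃ f y, c ∣ u * t ∧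
      Finsupp.linearCombination R h f = t • y ∧ x = u • f := by
  have hadd : ∀ (u t : R) (f : I →₀ R) (y : H) (v t' : R) (f' : I →₀ R) (y' : H), t ∉ L →
      t' ∉ L → c ∣ u * v * t → Finsupp.linearCombination R h f = t • y → c ∣ u * t' →
      Finsupp.linearCombination R h f' = t' • y' → ∃ u₁, ∃ t₁ ∉ L, ∃ f₁ y₁, c ∣ u₁ * t₁ ∧
        Finsupp.linearCombination R h f₁ = t₁ • y₁ ∧ (u * v) • f + u • f' = u₁ • f₁ := by
    intro u t f y v t' f' y' ht ht' hc hf hc' hf'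
    have hsum : (u * v) • f + u • f' = u • (v • f + f') := by rw [smul_add, smul_smul]
    rcases hR t' t with ⟨w, rfl⟩ | ⟨w, rfl⟩
    · refine ⟨u, t', ht', _, v • w • y + y', hc', ?_, hsum⟩
      rw [map_add, map_smul, hf, hf']
      module
    · rcases hR w v with ⟨v', rfl⟩ | ⟨w', rfl⟩
      · refine ⟨u, t * w, ht', _, v' • y + y', hc', ?_, hsum⟩
        rw [map_add, map_smul, hf, hf']
        module
      · refine ⟨u, t * v, fun h => ht' ?_, _, y + w' • y', ?_, ?_, hsum⟩
        · rw [← mul_assoc]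
          exact L.mul_mem_right _ h
        · rwa [mul_comm t, ← mul_assoc]
        · rw [map_add, map_smul, hf, hf']
          module
  refine ⟨{ carrier := {x | ∃ u, ∃ t ∉ L, ∃ f y, c ∣ u * t ∧
              Finsupp.linearCombination R h f = t • y ∧ x = u • f}
            zero_mem' := ⟨0, 1, (Ideal.ne_top_iff_one L).1 hL.ne_top, 0, 0, by simp, by simp,
              by simp⟩
            add_mem' := ?_
            smul_mem' := ?_ }, fun x => Iff.rfl⟩
  · rintro _ _ ⟨u, t, ht, f, y, hc, hf, rfl⟩ ⟨u', t', ht', f', y', hc', hf', rfl⟩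
    rcases hR u u' with ⟨v, rfl⟩ | ⟨v, rfl⟩
    · rw [add_comm]
      exact hadd u t' f' y' v t f y ht' ht hc' hf' hc hf
    · exact hadd u' t f y v t' f' y' ht ht' hc hf hc' hf'
  · rintro r _ ⟨u, t, ht, f, y, hc, hf, rfl⟩
    exact ⟨r * u, t, ht, f, y, by rw [mul_assoc]; exact hc.mul_left r, hf, by rw [mul_smul]⟩

/-- A vector `r • e` of the previous submodule, with `e` the basis vector of an element reflecting
divisibility, has `c ∣ r`. -/
theorem dvd_of_single_eq_smul (hR : ∀ a b : R, a ∣ b ∨ b ∣ a) (hL : L.IsPrime)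
    (hdvd : ∀ (x a : R) (y : H), x • h i₀ = a • y → ∃ z, x - a * z ∈ L)
    {r u t : R} (ht : t ∉ L) {f : I →₀ R} {y : H} (hc : c ∣ u * t)
    (hf : Finsupp.linearCombination R h f = t • y) (hr : Finsupp.single i₀ r = u • f) :
    c ∣ r := by
  classical
  have hr₀ : r = u * f i₀ := by simpa using DFunLike.congr_fun hr i₀
  have hr₁ : ∀ j, j ≠ i₀ → u * f j = 0 := fun j hj => by
    simpa [Finsupp.single_apply, Ne.symm hj] using (DFunLike.congr_fun hr j).symm
  obtain ⟨x, hxt, hxf, hx⟩ : ∃ x, x ∣ t ∧ (∀ j, j ≠ i₀ → x ∣ f j) ∧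
      (x = t ∨ ∃ j, j ≠ i₀ ∧ x = f j) := by
    by_cases hall : ∀ j, j ≠ i₀ → t ∣ f j
    · exact ⟨t, dvd_rfl, hall, Or.inl rfl⟩
    push Not at hall
    obtain ⟨j, hj, hjt⟩ := hall
    have hjs : j ∈ f.support.erase i₀ := by
      refine Finset.mem_erase.2 ⟨hj, Finsupp.mem_support_iff.2 fun h0 => hjt ?_⟩
      rw [h0]
      exact dvd_zero t
    obtain ⟨k, hk, hkd⟩ := exists_forall_dvd hR ⟨j, hjs⟩ f
    refine ⟨f k, (hR t (f k)).resolve_left fun h => hjt (h.trans (hkd j hjs)), fun i hi => ?_,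
      Or.inr ⟨k, (Finset.mem_erase.1 hk).1, rfl⟩⟩
    by_cases h0 : f i = 0
    · rw [h0]
      exact dvd_zero _
    · exact hkd i (Finset.mem_erase.2 ⟨hi, Finsupp.mem_support_iff.2 h0⟩)
  have hxL : x ∉ L := fun h => ht (L.mem_of_dvd hxt h)
  obtain ⟨g, hg⟩ := Finsupp.exists_eq_smul_of_forall_dvd (f := f.erase i₀) (x := x) fun j => by
    by_cases hj : j = i₀
    · simp [hj]
    · rw [Finsupp.erase_ne hj]
      exact hxf j hj
  obtain ⟨t', rfl⟩ := hxt
  obtain ⟨z, hz⟩ := hdvd (f i₀) x (t' • y - Finsupp.linearCombination R h g) (by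
    rw [← Finsupp.linearCombination_single R, eq_comm, smul_sub, ← mul_smul, ← hf, ← map_smul,
      ← hg, ← map_sub, ← Finsupp.single_add_erase i₀ f]
    simp)
  obtain ⟨l, -, hl⟩ := Ideal.exists_eq_mul_of_mem hR hL hxL hz
  have hfx : f i₀ = x * (z + l) := by rw [mul_add, ← hl]; ring
  rcases hx with hx | ⟨j, hj, rfl⟩
  · rw [hr₀, hfx, hx, ← mul_assoc]
    exact hc.mul_right _
  · rw [hr₀, hfx, ← mul_assoc, hr₁ j hj, zero_mul]
    exact dvd_zero c

/-- A submodule of the free module, maximal among those meeting the line of the basis vector at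
`i₀` inside its multiples by `c`. -/
theorem exists_maximal_submodule_single (hR : ∀ a b : R, a ∣ b ∨ b ∣ a) (hL : L.IsPrime)
    (hdvd : ∀ (x a : R) (y : H), x • h i₀ = a • y → ∃ z, x - a * z ∈ L) (c : R) :
    ∃ N : Submodule R (I →₀ R), (∀ r, Finsupp.single i₀ r ∈ N → c ∣ r) ∧
      (∀ (u t : R) (f : I →₀ R) (y : H), t ∉ L → c ∣ u * t →
        Finsupp.linearCombination R h f = t • y → u • f ∈ N) ∧
      ∀ N', N ≤ N' → N' ≠ N → ∃ r, Finsupp.single i₀ r ∈ N' ∧ ¬c ∣ r := by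
  obtain ⟨N₀, hN₀⟩ := exists_submodule_mem_iff_smul hR hL h c
  obtain ⟨N, hle, hN, hmax⟩ := exists_ge_maximal_submodule
    (fun N : Submodule R (I →₀ R) => ∀ r, Finsupp.single i₀ r ∈ N → c ∣ r)
    (fun C _ hC hmem _ r hr => by
      obtain ⟨N, hN, hrN⟩ := (hmem _).1 hr
      exact hC N hN r hrN) N₀
    (fun r hr => by
      obtain ⟨u, t, ht, f, y, hc, hf, hr⟩ := (hN₀ _).1 hr
      exact dvd_of_single_eq_smul hR hL hdvd ht hc hf hr)
  refine ⟨N, hN, fun u t f y ht hc hf => hle ((hN₀ _).2 ⟨u, t, ht, f, y, hc, hf, rfl⟩),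
    fun N' hNN' hne => ?_⟩
  by_contra! hcon
  exact hne (hmax N' hNN' hcon)

/-- In the quotient by the previous submodule, vectors having a coordinate equal to one stay
independent after localization at `L`. -/
theorem exists_notMem_dvd_mul_of_smul_mem [IsLocalRing R] (hR : ∀ a b : R, a ∣ b ∨ b ∣ a)
    (hL : L.IsPrime) (hc0 : c ≠ 0) (hcL : c ∈ L)
    (hann : ∀ r ∈ L, ∀ y : H, r • y = 0)
    (hind : ∀ f : I →₀ R, Finsupp.linearCombination R h f = 0 → ∀ i, f i ∈ L)
    (hess : ∀ y : H, y ≠ 0 → ∃ (d b t : R) (g : H), d • h i₀ - b • y = t • g ∧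
      ¬∃ z, d - t * z ∈ L)
    {N : Submodule R (I →₀ R)} (hN : ∀ r, Finsupp.single i₀ r ∈ N → c ∣ r)
    (hNmem : ∀ (u t : R) (f : I →₀ R) (y : H), t ∉ L → c ∣ u * t →
        Finsupp.linearCombination R h f = t • y → u • f ∈ N)
    {f : I →₀ R} {j : I} (hfj : f j = 1) {r s : R} (hs : s ∉ L) (hrs : (r * s) • f ∈ N) :
    ∃ s' ∉ L, c ∣ s' * r := by
  by_contra! hcon
  have h1L : (1 : R) ∉ L := (Ideal.ne_top_iff_one L).1 hL.ne_top
  have hmulL : ∀ {a b : R}, a ∉ L → b ∉ L → a * b ∉ L := fun ha hb hab =>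
    (hL.mem_or_mem hab).elim ha hb
  have hcF : ∀ (g : I →₀ R) (a : R), c ∣ a → a • g ∈ N := fun g a ha =>
    hNmem a 1 g _ h1L (by simpa using ha) (one_smul _ _).symm
  have hsub : ∀ d b : R, Finsupp.linearCombination R h (b • f - Finsupp.single i₀ d) =
      -(d • h i₀ - b • Finsupp.linearCombination R h f) := by
    intro d b
    rw [map_sub, map_smul, Finsupp.linearCombination_single, neg_sub]
  have hf0 : Finsupp.linearCombination R h f ≠ 0 := fun h0 => by
    have := hind f h0 j
    rw [hfj] at this
    exact h1L this
  obtain ⟨d, b, t, g, hg, hdt⟩ := hess _ hf0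
  have hdL : d ∉ L := fun hd => hdt ⟨0, by simpa using hd⟩
  by_cases htL : t ∈ L
  · obtain ⟨q, rfl⟩ : r ∣ c := (hR r c).resolve_right fun h => hcon 1 h1L (by simpa using h)
    have hqL : q ∈ L := by
      by_contra hq
      exact hcon q hq (by rw [mul_comm])
    have hcoef := hind (b • f - Finsupp.single i₀ d) (by
      rw [hsub, hg, hann t htL, neg_zero])
    obtain ⟨l, hlL, f', hf'⟩ : ∃ l ∈ L, ∃ f', b • f - Finsupp.single i₀ d = l • f' := by
      by_cases h0 : b • f - Finsupp.single i₀ d = 0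
      · exact ⟨0, L.zero_mem, 0, by simp [h0]⟩
      · obtain ⟨k, f', hk, -⟩ := Finsupp.exists_eq_smul_and_apply_eq_one hR h0
        exact ⟨_, hcoef k, f', hk⟩
    have hmem : (b * (r * s)) • f ∈ N := by
      rw [mul_smul]
      exact N.smul_mem _ hrs
    have hbf : b • f = Finsupp.single i₀ d + l • f' := by rw [← hf']; abel
    rcases hR q l with ⟨l', rfl⟩ | ⟨q', rfl⟩
    · refine hcon (s * d) (hmulL hs hdL) (hN _ ?_)
      have : Finsupp.single i₀ (s * d * r) =
          (b * (r * s)) • f - (r * q * (l' * s)) • f' := by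
        rw [mul_comm b, mul_smul, hbf, smul_add, smul_smul, Finsupp.smul_single, smul_eq_mul,
          show s * d * r = r * s * d by ring, show r * q * (l' * s) = r * s * (q * l') by ring]
        abel
      rw [this]
      exact N.sub_mem hmem (hcF _ _ ⟨_, rfl⟩)
    · have hmem' : Finsupp.single i₀ (r * q' * s * d) ∈ N := by
        have : Finsupp.single i₀ (r * q' * s * d) =
            q' • ((b * (r * s)) • f) - (r * (l * q') * s) • f' := by
          rw [mul_comm b, mul_smul (r * s), hbf, smul_add, smul_smul, Finsupp.smul_single,
            smul_eq_mul, smul_add, Finsupp.smul_single, smul_eq_mul, smul_smul,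
            show q' * (r * s * d) = r * q' * s * d by ring,
            show q' * (r * s * l) = r * (l * q') * s by ring]
          abel
        rw [this]
        exact N.sub_mem (N.smul_mem _ hmem) (hcF _ _ ⟨s, rfl⟩)
      obtain ⟨y, hy⟩ := hN _ hmem'
      obtain ⟨p, hp, rfl⟩ := Ideal.exists_eq_mul_of_mem hR hL (hmulL hs hdL) hlL
      have h0 : r * q' * s * d = 0 :=
        eq_zero_of_eq_smul_of_not_isUnit (p := p * y)
          (hL.not_isUnit_of_mem (L.mul_mem_right _ hp)) (by
            rw [smul_eq_mul]
            calc r * q' * s * d = r * (s * d * p * q') * y := hy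
              _ = p * y * (r * q' * s * d) := by ring)
      exact hc0 (by
        calc r * (s * d * p * q') = r * q' * s * d * p := by ring
          _ = 0 := by rw [h0, zero_mul])
  · obtain ⟨t₁, rfl⟩ : d ∣ t := (hR d t).resolve_right fun ⟨z, hz⟩ => hdt ⟨z, by simp [hz]⟩
    have ht₁ : ¬IsUnit t₁ := by
      intro hu
      obtain ⟨v, hv⟩ := hu.exists_right_inv
      exact hdt ⟨v, by rw [mul_assoc, hv, mul_one, sub_self]; exact L.zero_mem⟩
    obtain ⟨u, -, rfl⟩ := Ideal.exists_eq_mul_of_mem hR hL htL hcL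
    have hmem : u • (b • f - Finsupp.single i₀ d) ∈ N :=
      hNmem u (d * t₁) _ (-g) htL (by rw [mul_comm]) (by rw [hsub, hg, smul_neg])
    have hub : (u * b) • f ∈ N := by
      rcases hR (r * s) (u * b) with ⟨v, hv⟩ | ⟨v, hv⟩
      · rw [hv, mul_comm, mul_smul]
        exact N.smul_mem _ hrs
      · refine absurd ?_ (hcon (s * (d * t₁)) (hmulL hs htL))
        exact ⟨b * v, by
          calc s * (d * t₁) * r = d * t₁ * (r * s) := by ring
            _ = d * t₁ * u * (b * v) := by rw [hv]; ring⟩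
    have hud : Finsupp.single i₀ (u * d) ∈ N := by
      have : Finsupp.single i₀ (u * d) = (u * b) • f - u • (b • f - Finsupp.single i₀ d) := by
        rw [smul_sub, smul_smul, Finsupp.smul_single, smul_eq_mul]
        abel
      rw [this]
      exact N.sub_mem hub hmem
    obtain ⟨y, hy⟩ := hN _ hud
    have h0 : u * d = 0 := eq_zero_of_eq_smul_of_not_isUnit (p := t₁ * y)
      (fun hu => ht₁ (isUnit_of_mul_isUnit_left hu)) (by
        rw [smul_eq_mul]
        calc u * d = d * t₁ * u * y := hy
          _ = t₁ * y * (u * d) := by ring)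
    exact hc0 (by
      calc d * t₁ * u = u * d * t₁ := by ring
        _ = 0 := by rw [h0, zero_mul])

end UniformQuotient

section MalcevRank

variable {D : Type u} [CommRing D] [IsDomain D] {H : Type u} [AddCommGroup H] [Module D H]

theorem NoTorsion.isTorsionFree (hH : NoTorsion D H) : Module.IsTorsionFree D H :=
  Module.IsTorsionFree.of_smul_eq_zero fun a y h => hH a y h

/-- A linearly independent set extends to one such that every element has a nonzero multiple in
its span. -/
theorem LinearIndepOn.exists_extend_forall_smul_mem_span [Module.IsTorsionFree D H] {s : Set H}
    (hs : LinearIndepOn D id s) : ∃ t, s ⊆ t ∧ LinearIndepOn D id t ∧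
      ∀ y : H, ∃ a : D, a ≠ 0 ∧ a • y ∈ Submodule.span D t := by
  obtain ⟨t, hst, hmax⟩ := zorn_subset_nonempty {t : Set H | LinearIndepOn D id t}
    (fun c hc hchain _ => ⟨⋃₀ c,
      linearIndepOn_sUnion_of_directed hchain.directedOn fun x hx => hc hx,
      fun _ => Set.subset_sUnion_of_mem⟩) s hs
  refine ⟨t, hst, hmax.prop, fun y => ?_⟩
  by_contra! hcon
  have hy : y ≠ 0 := by
    rintro rfl
    exact hcon 1 one_ne_zero (by simp)
  have hunion : LinearIndepOn D id (t ∪ {y}) := by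
    refine LinearIndepOn.id_union hmax.prop ((linearIndepOn_singleton_iff D).2 hy) ?_
    rw [Submodule.disjoint_def]
    intro z hz hzy
    obtain ⟨a, rfl⟩ := Submodule.mem_span_singleton.1 hzy
    by_cases ha : a = 0
    · simp [ha]
    · exact absurd hz (hcon a ha)
  have hyt : y ∈ t := hmax.le_of_ge hunion Set.subset_union_left (Or.inr rfl)
  exact hcon 1 one_ne_zero (by simpa using Submodule.subset_span hyt)

theorem malcevRankLE_of_forall_smul_mem_span [ValuationRing D] [Module.IsTorsionFree D H]
    {t : Set H} [Fintype t] (ht : ∀ y : H, ∃ a : D, a ≠ 0 ∧ a • y ∈ Submodule.span D t) :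
    MalcevRankLE D H (Fintype.card t) := by
  classical
  intro X hX
  have : Module.Finite D X := Module.Finite.iff_fg.2 hX
  have : Module.Flat D X := by
    rw [Module.Flat.flat_iff_torsion_eq_bot_of_isBezout,
      ← Submodule.isTorsionFree_iff_torsion_eq_bot]
    infer_instance
  have : Module.Free D X := Module.free_of_flat_of_isLocalRing
  let b := Module.Free.chooseBasis D X
  choose a ha hat using fun k => ht (b k : H)
  have hprod : ∏ k, a k ≠ 0 := Finset.prod_ne_zero_iff.2 fun k _ => ha k
  have hli := (b.linearIndependent.map' X.subtype X.ker_subtype).map'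
    (LinearMap.lsmul D H (∏ k, a k)) (LinearMap.ker_eq_bot.2
      (smul_right_injective H hprod))
  have hcard := linearIndependent_le_span' _ hli t (by
    rintro _ ⟨k, rfl⟩
    change (∏ k, a k) • (b k : H) ∈ Submodule.span D t
    rw [← Finset.prod_erase_mul _ _ (Finset.mem_univ k), mul_smul]
    exact Submodule.smul_mem _ _ (hat k))
  rw [Cardinal.mk_fintype, Nat.cast_le] at hcard
  refine ⟨Finset.univ.image fun k => (b k : H), ?_, Finset.card_image_le.trans hcard, ?_⟩
  · intro y hy
    obtain ⟨k, -, rfl⟩ := Finset.mem_image.1 hy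
    exact (b k).2
  · have : ((Finset.univ.image fun k => (b k : H) : Finset H) : Set H) =
        X.subtype '' Set.range b := by
      rw [← Set.range_comp]
      ext y
      simp
    rw [this, Submodule.span_image, b.span_eq, Submodule.map_top, Submodule.range_subtype]

end MalcevRank

section ResidueDomain

variable {R : Type u} [CommRing R]

theorem dvd_total_of_ideal_total (hchain : ∀ I J : Ideal R, I ≤ J ∨ J ≤ I) (a b : R) :
    a ∣ b ∨ b ∣ a := by
  rcases hchain (Ideal.span {a}) (Ideal.span {b}) with h | h
  · exact Or.inr (Ideal.span_singleton_le_span_singleton.1 h)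
  · exact Or.inl (Ideal.span_singleton_le_span_singleton.1 h)

theorem valuationRing_quotient (hR : ∀ a b : R, a ∣ b ∨ b ∣ a) (L : Ideal R) [L.IsPrime] :
    ValuationRing (R ⧸ L) := by
  refine ValuationRing.iff_dvd_total.2 ⟨fun a b => ?_⟩
  obtain ⟨a, rfl⟩ := Ideal.Quotient.mk_surjective a
  obtain ⟨b, rfl⟩ := Ideal.Quotient.mk_surjective b
  exact (hR a b).imp (map_dvd _) (map_dvd _)

theorem noTorsion_quotient (L : Ideal R) [L.IsPrime] : NoTorsion (R ⧸ L) (R ⧸ L) :=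
  fun _ _ h => mul_eq_zero.1 h

end ResidueDomain

section FiniteRank

variable {R : Type u} [CommRing R] [IsLocalRing R]

/-- If localization at `L` preserves finite Goldie dimension, families containing the unit element
that are independent modulo `L` in an essential extension of `R ⧸ L` are finite. -/
theorem finite_of_forall_hasFiniteGoldieDimension (hR : ∀ a b : R, a ∣ b ∨ b ∣ a)
    {L : Ideal R} [hL : L.IsPrime]
    (hfin : ∀ (M : Type u) [AddCommGroup M] [Module R M], HasFiniteGoldieDimension R M →
      HasFiniteGoldieDimension (Localization.AtPrime L) (LocalizedModule L.primeCompl M))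
    (hL0 : L ≠ ⊥) {H : Type*} [AddCommGroup H] [Module R H] {I : Type u} {h : I → H} {i₀ : I}
    (hdvd : ∀ (x a : R) (y : H), x • h i₀ = a • y → ∃ z, x - a * z ∈ L)
    (hann : ∀ r ∈ L, ∀ y : H, r • y = 0)
    (hind : ∀ f : I →₀ R, Finsupp.linearCombination R h f = 0 → ∀ i, f i ∈ L)
    (hess : ∀ y : H, y ≠ 0 → ∃ (d b t : R) (g : H), d • h i₀ - b • y = t • g ∧
      ¬∃ z, d - t * z ∈ L) : Finite I := by
  classical
  obtain ⟨c, hcL, hc0⟩ := (Submodule.ne_bot_iff L).1 hL0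
  have h1L : (1 : R) ∉ L := (Ideal.ne_top_iff_one L).1 hL.ne_top
  obtain ⟨N, hN, hNmem, hmax⟩ := exists_maximal_submodule_single hR hL hdvd c
  have hkey : ∀ (f : I →₀ R) (j : I), f j = 1 → ∀ r s, s ∉ L → (r * s) • f ∈ N →
      ∃ s' ∉ L, c ∣ s' * r := fun f j hfj r s hs hrs =>
    exists_notMem_dvd_mul_of_smul_mem hR hL hc0 hcL hann hind hess hN hNmem hfj hs hrs
  have hgoldie : HasFiniteGoldieDimension R ((I →₀ R) ⧸ N) := by
    have hmeet : ∀ A : Submodule R ((I →₀ R) ⧸ N), A ≠ ⊥ → ∃ r,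
        N.mkQ (Finsupp.single i₀ r) ∈ A ∧ ¬c ∣ r := by
      intro A hA
      refine hmax (A.comap N.mkQ) ?_ ?_
      · intro x hx
        rw [Submodule.mem_comap, Submodule.mkQ_apply, (Submodule.Quotient.mk_eq_zero N).2 hx]
        exact A.zero_mem
      · intro h
        apply hA
        rw [← Submodule.map_comap_eq_of_surjective N.mkQ_surjective A, h, ← le_bot_iff,
          Submodule.map_le_iff_le_comap, Submodule.comap_bot, Submodule.ker_mkQ]
    intro κ A hA hAind
    refine @Finite.of_subsingleton _ ⟨fun i j => ?_⟩
    by_contra hij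
    obtain ⟨r, hrA, hr⟩ := hmeet _ (hA i)
    obtain ⟨r', hrA', hr'⟩ := hmeet _ (hA j)
    obtain ⟨w, hwi, hwj, hw⟩ : ∃ w, N.mkQ (Finsupp.single i₀ w) ∈ A i ∧
        N.mkQ (Finsupp.single i₀ w) ∈ A j ∧ ¬c ∣ w := by
      have hmul : ∀ {B : Submodule R ((I →₀ R) ⧸ N)} {a : R} (q : R),
          N.mkQ (Finsupp.single i₀ a) ∈ B → N.mkQ (Finsupp.single i₀ (a * q)) ∈ B := by
        intro B a q hB
        rw [mul_comm, ← smul_eq_mul, ← Finsupp.smul_single, map_smul]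
        exact B.smul_mem _ hB
      rcases hR r r' with ⟨q, rfl⟩ | ⟨q, rfl⟩
      · exact ⟨_, hmul q hrA, hrA', hr'⟩
      · exact ⟨_, hrA, hmul q hrA', hr⟩
    have hmem : N.mkQ (Finsupp.single i₀ w) ∈ A i ⊓ ⨆ k : {k // k ≠ i}, A k.1 :=
      ⟨hwi, Submodule.mem_iSup_of_mem (p := fun k : {k // k ≠ i} => A k.1)
        ⟨j, fun h => hij h.symm⟩ hwj⟩
    rw [hAind i, Submodule.mem_bot, Submodule.mkQ_apply, Submodule.Quotient.mk_eq_zero] at hmem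
    exact hw (hN w hmem)
  have hlin : ∀ f : I →₀ R, Finsupp.linearCombination R
      (fun i => N.mkQ (Finsupp.single i 1)) f = N.mkQ f := by
    intro f
    rw [Finsupp.linearCombination_apply, Finsupp.sum]
    conv_rhs => rw [← Finsupp.sum_single f, Finsupp.sum, map_sum]
    refine Finset.sum_congr rfl fun i _ => ?_
    rw [← map_smul, Finsupp.smul_single, smul_eq_mul, mul_one]
  have hzero : ∀ (r : R) (f : I →₀ R), r • N.mkQ f = 0 ↔ r • f ∈ N := by
    intro r f
    rw [← map_smul, Submodule.mkQ_apply, Submodule.Quotient.mk_eq_zero]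
  refine IndepOutside.finite (L := L) (x := fun i => N.mkQ (Finsupp.single i 1)) ⟨?_, ?_⟩
    (hfin _ hgoldie)
  · rintro i ⟨s, hs, h0⟩
    obtain ⟨s', hs', hc⟩ := hkey _ i (Finsupp.single_eq_same) 1 s hs (by
      rw [one_mul, ← hzero]
      exact h0)
    rw [mul_one] at hc
    exact hs' (L.mem_of_dvd hc hcL)
  · rintro f ⟨s, hs, h0⟩ i
    rw [hlin] at h0
    by_cases hf : f = 0
    · subst hf
      simpa using IsTorsionOutside.zero hL
    obtain ⟨j, g, hfg, hgj⟩ := Finsupp.exists_eq_smul_and_apply_eq_one hR hf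
    obtain ⟨s', hs', hc⟩ := hkey g j hgj (f j) s hs (by
      rw [mul_comm, mul_smul, ← hfg, ← hzero]
      exact h0)
    refine ⟨s', hs', ?_⟩
    rw [smul_smul, hzero]
    refine hNmem _ 1 _ _ h1L ?_ (one_smul _ _).symm
    have : f i = f j * g i := by simpa using DFunLike.congr_fun hfg i
    rw [mul_one, this, ← mul_assoc]
    exact hc.mul_right _

theorem exists_malcevRankLE_of_forall_hasFiniteGoldieDimension
    (hR : ∀ a b : R, a ∣ b ∨ b ∣ a) {L : Ideal R} [hL : L.IsPrime]
    (hfin : ∀ (M : Type u) [AddCommGroup M] [Module R M], HasFiniteGoldieDimension R M →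
      HasFiniteGoldieDimension (Localization.AtPrime L) (LocalizedModule L.primeCompl M))
    (hL0 : L ≠ ⊥) {H : Type u} [AddCommGroup H] [Module (R ⧸ L) H] {j : (R ⧸ L) →ₗ[R ⧸ L] H}
    (hj : ReflectsDvd j) (hess : DvdEssential j) : ∃ k, MalcevRankLE (R ⧸ L) H k := by
  classical
  have := valuationRing_quotient hR L
  have hT : NoTorsion (R ⧸ L) H := .of_dvdEssential hj hess (noTorsion_quotient L)
  have := hT.isTorsionFree
  let _ : Module R H := Module.compHom H (Ideal.Quotient.mk L)
  have hsmul : ∀ (r : R) (y : H), r • y = Ideal.Quotient.mk L r • y := fun _ _ => rfl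
  have hj1 : j 1 ≠ 0 := fun h => one_ne_zero (hj.injective (h.trans (map_zero j).symm))
  have hjr : ∀ r : R, j (Ideal.Quotient.mk L r) = r • j 1 := fun r => by
    rw [hsmul, ← map_smul, smul_eq_mul, mul_one]
  obtain ⟨t, hst, hti, htspan⟩ :=
    ((linearIndepOn_singleton_iff (R ⧸ L) (v := id)).2 hj1).exists_extend_forall_smul_mem_span
  have hdvd_iff : ∀ x a : R, (∃ z, Ideal.Quotient.mk L x = Ideal.Quotient.mk L a • z) ↔
      ∃ z, x - a * z ∈ L := by
    intro x a
    refine (Ideal.Quotient.mk_surjective (I := L)).exists.trans (exists_congr fun z => ?_)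
    rw [← Ideal.Quotient.eq, smul_eq_mul, map_mul]
  have hfinite : Finite t := by
    refine finite_of_forall_hasFiniteGoldieDimension (L := L) hR hfin hL0
      (h := fun y : t => (y : H)) (i₀ := ⟨j 1, hst rfl⟩) ?_ ?_ ?_ ?_
    · intro x a y hxy
      exact (hdvd_iff x a).1 (hj _ (Ideal.Quotient.mk L a) y (by rw [hjr, hxy, hsmul]))
    · intro r hr y
      rw [hsmul, Ideal.Quotient.eq_zero_iff_mem.2 hr, zero_smul]
    · intro f hf i
      rw [← Ideal.Quotient.eq_zero_iff_mem]
      have := linearIndependent_iff.1 hti (f.mapRange (Ideal.Quotient.mk L) (map_zero _)) (by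
        rw [Finsupp.linearCombination_apply]
        exact (Finsupp.sum_mapRange_index (h := fun (y : t) (a : R ⧸ L) => a • (y : H))
          fun _ => zero_smul _ _).trans hf)
      simpa using DFunLike.congr_fun this i
    · intro y hy
      obtain ⟨x, b, a, g, h1, h2⟩ := hess y hy
      obtain ⟨x, rfl⟩ := Ideal.Quotient.mk_surjective x
      obtain ⟨b, rfl⟩ := Ideal.Quotient.mk_surjective b
      obtain ⟨a, rfl⟩ := Ideal.Quotient.mk_surjective a
      refine ⟨x, b, a, g, ?_, fun h => h2 ((hdvd_iff x a).2 h)⟩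
      rw [← hjr]
      exact h1
  have := Fintype.ofFinite t
  exact ⟨_, malcevRankLE_of_forall_smul_mem_span htspan⟩

end FiniteRank

section UniformModule

variable {R : Type*} [CommRing R] {E : Type*} [AddCommGroup E] [Module R E] {ι : Type*}
  {L : Ideal R} {x : ι → E}

theorem IndepOutside.smul_ne_zero (hx : IndepOutside L x) (i : ι) {r : R} (hr : r ∉ L) :
    r • x i ≠ 0 :=
  fun h => hx.1 i ⟨r, hr, h⟩

variable [Fintype ι]

theorem IndepOutside.isTorsionOutside_smul (hx : IndepOutside L x) {f : ι → R}
    (hf : IsTorsionOutside L (Fintype.linearCombination R x f)) (i : ι) :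
    IsTorsionOutside L (f i • x i) := by
  refine hx.2 ((Finsupp.linearEquivFunOnFinite R R ι).symm f) ?_ i
  rwa [Finsupp.linearCombination_eq_fintype_linearCombination_apply R]

/-- In a uniform module, two independent directions at `L` force torsion by an element outside
of `L`. -/
theorem IndepOutside.exists_smul_eq_zero (hU : ∀ y z : E, y ≠ 0 → z ≠ 0 →
      ∃ a b : R, a • y = b • z ∧ a • y ≠ 0)
    (hL : L.IsPrime) (hx : IndepOutside L x) {i j : ι} (hij : i ≠ j) :
    ∃ s ∉ L, ∃ z : E, z ≠ 0 ∧ s • z = 0 := by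
  classical
  have hne : ∀ k, x k ≠ 0 := fun k h => hx.1 k (h ▸ .zero hL)
  obtain ⟨a, b, hab, ha⟩ := hU (x i) (x j) (hne i) (hne j)
  obtain ⟨s, hs, h⟩ := hx.isTorsionOutside_smul
    (f := Pi.single i a - Pi.single j b) (by
      rw [map_sub, Fintype.linearCombination_apply_single, Fintype.linearCombination_apply_single,
        hab, sub_self]
      exact .zero hL) i
  refine ⟨s, hs, a • x i, ha, ?_⟩
  simpa [Pi.single_eq_of_ne hij] using h

/-- `f / t` approximates a multiple of the base vector `e`, with coefficients evaluated at `x`. -/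
def ApproxMultiple (x : ι → E) (e : E) (t : R) (f : ι → R) : Prop :=
  ∃ r m : R, m • Fintype.linearCombination R x f = (m * r * t) • e ∧ (m * t) • e ≠ 0

theorem ApproxMultiple.smul {e : E} {t : R} {f : ι → R} (h : ApproxMultiple x e t f) (a : R) :
    ApproxMultiple x e t (a • f) := by
  obtain ⟨r, m, h1, h2⟩ := h
  refine ⟨a * r, m, ?_, h2⟩
  rw [map_smul, smul_comm, h1, smul_smul]
  ring_nf

theorem ApproxMultiple.add (hR : ∀ a b : R, a ∣ b ∨ b ∣ a) {e : E} {t : R} {f g : ι → R}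
    (hf : ApproxMultiple x e t f) (hg : ApproxMultiple x e t g) :
    ApproxMultiple x e t (f + g) := by
  wlog h : ∃ r m n, m • Fintype.linearCombination R x f = (m * r * t) • e ∧ (m * n * t) • e ≠ 0 ∧
    ∃ r', (m * n) • Fintype.linearCombination R x g = (m * n * r' * t) • e generalizing f g
  · obtain ⟨r, m, h1, h2⟩ := id hf
    obtain ⟨r', m', h1', h2'⟩ := id hg
    rcases hR m m' with ⟨n, rfl⟩ | ⟨n, rfl⟩
    · exact (h ⟨r, m, n, h1, h2', r', h1'⟩).elim
    · rw [add_comm]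
      exact this hg hf ⟨r', m', n, h1', h2, r, h1⟩
  obtain ⟨r, m, n, h1, h2, r', h3⟩ := h
  refine ⟨r + r', m * n, ?_, h2⟩
  rw [map_add, smul_add, h3, mul_comm m n, mul_smul, h1, smul_smul, ← add_smul]
  ring_nf

theorem ApproxMultiple.mul_smul_mul (hR : ∀ a b : R, a ∣ b ∨ b ∣ a) (hL : L.IsPrime) {e : E}
    (he : ∀ r ∉ L, r • e ≠ 0) {s t : R} (hs : s ∉ L) (ht : t ∉ L) {f : ι → R}
    (h : ApproxMultiple x e t f) : ApproxMultiple x e (s * t) (s • f) := by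
  obtain ⟨r, m, h1, h2⟩ := h
  rcases hR s m with ⟨n, rfl⟩ | ⟨n, rfl⟩
  · refine ⟨r, n, ?_, ?_⟩
    · rw [map_smul, smul_smul, mul_comm n s, h1]
      ring_nf
    · convert h2 using 2
      ring
  · refine ⟨r, 1, ?_, ?_⟩
    · rw [map_smul, one_smul, mul_comm m n, mul_smul, h1, smul_smul]
      ring_nf
    · rw [one_mul]
      exact he _ fun h => (hL.mem_or_mem h).elim hs ht

/-- The residue of an element in the fraction field of `R ⧸ L`. -/
noncomputable def residueFraction (L : Ideal R) : R →+* FractionRing (R ⧸ L) :=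
  (algebraMap (R ⧸ L) (FractionRing (R ⧸ L))).comp (Ideal.Quotient.mk L)

theorem residueFraction_eq_zero [L.IsPrime] {r : R} : residueFraction L r = 0 ↔ r ∈ L := by
  rw [residueFraction, RingHom.comp_apply,
    map_eq_zero_iff _ (IsFractionRing.injective (R ⧸ L) (FractionRing (R ⧸ L))),
    Ideal.Quotient.eq_zero_iff_mem]

theorem mk_smul_fraction (r : R) (v : FractionRing (R ⧸ L)) :
    Ideal.Quotient.mk L r • v = residueFraction L r * v :=
  Algebra.smul_def _ _

/-- The fractions of vectors that approximate a multiple of the base vector form a submodule. -/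
theorem exists_submodule_mem_iff_approxMultiple (hR : ∀ a b : R, a ∣ b ∨ b ∣ a) [hL : L.IsPrime]
    {e : E} (he : ∀ r ∉ L, r • e ≠ 0) :
    ∃ C : Submodule (R ⧸ L) (ι → FractionRing (R ⧸ L)), ∀ v, v ∈ C ↔ ∃ t ∉ L, ∃ f : ι → R,
      (∀ i, residueFraction L t * v i = residueFraction L (f i)) ∧ ApproxMultiple x e t f := by
  refine ⟨{
    carrier := {v | ∃ t ∉ L, ∃ f : ι → R,
      (∀ i, residueFraction L t * v i = residueFraction L (f i)) ∧ ApproxMultiple x e t f}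
    zero_mem' := ?_
    add_mem' := ?_
    smul_mem' := ?_ }, fun v => Iff.rfl⟩
  · rintro v w ⟨s, hs, f, hf, hf'⟩ ⟨t, ht, g, hg, hg'⟩
    refine ⟨s * t, fun h => (hL.mem_or_mem h).elim hs ht, t • f + s • g, fun i => ?_, ?_⟩
    · simp only [Pi.add_apply, Pi.smul_apply, smul_eq_mul, map_add, map_mul, ← hf, ← hg]
      ring
    · refine .add hR ?_ (hg'.mul_smul_mul hR hL he hs ht)
      rw [mul_comm]
      exact hf'.mul_smul_mul hR hL he ht hs
  · have h1 : (1 : R) ∉ L := (Ideal.ne_top_iff_one L).1 hL.ne_top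
    exact ⟨1, h1, 0, by simp, 0, 1, by simp, by simpa using he 1 h1⟩
  · rintro a v ⟨t, ht, f, hf, hf'⟩
    obtain ⟨a, rfl⟩ := Ideal.Quotient.mk_surjective a
    refine ⟨t, ht, a • f, fun i => ?_, hf'.smul a⟩
    rw [Pi.smul_apply, Pi.smul_apply, mk_smul_fraction, smul_eq_mul, map_mul, ← hf]
    ring

theorem smul_linearCombination_eq_zero_of_forall_mem (hR : ∀ a b : R, a ∣ b ∨ b ∣ a)
    (hU : ∀ y z : E, y ≠ 0 → z ≠ 0 → ∃ a b : R, a • y = b • z ∧ a • y ≠ 0)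
    (hL : L.IsPrime) (hann : ∀ (i j : ι) (r : R), r • x i = 0 → r • x j = 0)
    {s : R} (hs : s ∉ L) {z : E} (hz : z ≠ 0) (hsz : s • z = 0) {j : ι} {y : R} {l : ι → R}
    (hl : ∀ i, l i ∈ L) (h : y • x j = y • Fintype.linearCombination R x l) : y • x j = 0 := by
  by_contra hy
  obtain ⟨k, -, hk⟩ := exists_forall_dvd hR ⟨j, Finset.mem_univ j⟩ l
  obtain ⟨a, b, hab, ha⟩ := hU (y • x j) z hy hz
  obtain ⟨l', -, hl'⟩ := Ideal.exists_eq_mul_of_mem hR hL hs (hl k)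
  have hkill : (a * y * l k) • x j = 0 := by
    have : (a * y * l k) • x j = l k • a • y • x j := by
      rw [smul_smul, smul_smul]; ring_nf
    rw [this, hab, hl', smul_comm, mul_comm, mul_smul, hsz, smul_zero, smul_zero]
  apply ha
  rw [h, smul_smul, Fintype.linearCombination_apply, Finset.smul_sum]
  refine Finset.sum_eq_zero fun i _ => ?_
  obtain ⟨c, hc⟩ := hk i (Finset.mem_univ i)
  have : (a * y) • l i • x i = c • (a * y * l k) • x i := by
    rw [hc, smul_smul, smul_smul]; ring_nf
  rw [this, hann j i _ hkill, smul_zero]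

theorem exists_smul_sub_eq_zero (hR : ∀ a b : R, a ∣ b ∨ b ∣ a)
    (hU : ∀ y z : E, y ≠ 0 → z ≠ 0 → ∃ a b : R, a • y = b • z ∧ a • y ≠ 0)
    (hL : L.IsPrime) (hx : IndepOutside L x)
    (hann : ∀ (i j : ι) (r : R), r • x i = 0 → r • x j = 0) (j : ι) {f : ι → R} {i : ι}
    (hf : f i ∉ L) : ∃ m b : R, ∃ q ∉ L,
      m • (q • x j - b • Fintype.linearCombination R x f) = 0 ∧ (m * q) • x j ≠ 0 := by
  classical
  have h1 : (1 : R) ∉ L := (Ideal.ne_top_iff_one L).1 hL.ne_top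
  have hF : Fintype.linearCombination R x f ≠ 0 := by
    intro h
    exact hx.1 i (.of_smul hL hf (hx.isTorsionOutside_smul (h ▸ .zero hL) i))
  obtain ⟨b, a, hab, hb⟩ := hU _ (x j) hF (by simpa using hx.smul_ne_zero j h1)
  rcases hR a b with ⟨q, rfl⟩ | ⟨q, rfl⟩
  · refine ⟨a, q, 1, h1, ?_, ?_⟩
    · rw [one_smul, smul_sub, smul_smul, hab, sub_self]
    · rwa [mul_one, ← hab]
  · refine ⟨b, 1, q, fun hq => ?_, ?_, by rwa [← hab]⟩
    · have hfi : (f - q • Pi.single j 1 : ι → R) i ∉ L := by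
        intro h
        refine hf ?_
        have := L.add_mem h (L.mul_mem_right (Pi.single (M := fun _ => R) j 1 i) hq)
        simpa using this
      have h0 : Fintype.linearCombination R x (b • (f - q • Pi.single j 1 : ι → R)) = 0 := by
        rw [map_smul, map_sub, map_smul, Fintype.linearCombination_apply_single, one_smul,
          smul_sub, hab, smul_smul, sub_self]
      have ht := hx.isTorsionOutside_smul (h0 ▸ IsTorsionOutside.zero (M := E) hL) i
      rw [Pi.smul_apply, smul_eq_mul, mul_comm, mul_smul] at ht
      obtain ⟨s, hs, h⟩ := IsTorsionOutside.of_smul hL hfi ht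
      obtain ⟨q', -, rfl⟩ := Ideal.exists_eq_mul_of_mem hR hL hs hq
      have h := hann i j (s * b) (by rw [mul_smul, h])
      apply hb
      rw [hab, show b * (s * q') = q' * (s * b) by ring, mul_smul, h, smul_zero]
    · rw [one_smul, smul_sub, smul_smul, hab, sub_self]

/-- An annihilated difference is approximated by a multiple of `e` by a nonunit outside of `L`. -/
theorem exists_nonunit_smul_sub_eq_zero (hR : ∀ a b : R, a ∣ b ∨ b ∣ a)
    (hU : ∀ y z : E, y ≠ 0 → z ≠ 0 → ∃ a b : R, a • y = b • z ∧ a • y ≠ 0)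
    (hL : L.IsPrime) {e : E} (he : ∀ r ∉ L, r • e ≠ 0) {s : R} (hs : s ∉ L) (hsu : ¬IsUnit s)
    {q m : R} (hq : q ∉ L) {z : E} (hmz : m • z = 0) (hmq : (m * q) • e ≠ 0) :
    ∃ t ∉ L, ¬IsUnit t ∧ ∃ r m' : R, m' • z = (m' * r * (q * t)) • e ∧ (m' * (q * t)) • e ≠ 0 := by
  have hqs : (q * s) • e ≠ 0 := he _ fun h => (hL.mem_or_mem h).elim hq hs
  by_cases hz : z = 0
  · exact ⟨s, hs, hsu, 0, 1, by simp [hz], by simpa using hqs⟩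
  obtain ⟨a, b, hab, ha⟩ := hU z ((q * s) • e) hz hqs
  rcases hR a b with ⟨c, rfl⟩ | ⟨c, rfl⟩
  · refine ⟨s, hs, hsu, c, a, ?_, fun h => ha ?_⟩
    · rw [hab, smul_smul]
    · rw [hab, mul_comm a c, mul_smul, smul_smul a, h, smul_zero]
  by_cases hsc : s ∣ c
  · obtain ⟨d, rfl⟩ := hsc
    have h1 : (b * s * q) • e = (b * s * d) • z := by
      rw [mul_assoc b s d, hab, smul_smul]; ring_nf
    have h2 : (b * s * d) • z ≠ 0 := by rwa [mul_assoc]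
    rcases hR (b * s) m with ⟨n, rfl⟩ | ⟨n, hn⟩
    · refine (hmq ?_).elim
      rw [show b * s * n * q = n * (b * s * q) by ring, mul_smul, h1, smul_smul,
        show n * (b * s * d) = d * (b * s * n) by ring, mul_smul, hmz, smul_zero]
    · refine (h2 ?_).elim
      rw [hn, show m * n * d = n * d * m by ring, mul_smul, hmz, smul_zero]
  · obtain ⟨t, rfl⟩ := (hR s c).resolve_left hsc
    refine ⟨t, fun h => hs (L.mul_mem_left _ h), fun h => hsc ?_, 1, b * c, ?_, ?_⟩
    · exact (h.mul_right_dvd).2 dvd_rfl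
    · rw [hab, smul_smul]; ring_nf
    · rw [hab, smul_smul] at ha
      convert ha using 2
      ring

end UniformModule

section UniformLinearIndependence

variable {R : Type u} [CommRing R] [IsLocalRing R] {E : Type u} [AddCommGroup E] [Module R E]
  {L : Ideal R} [hL : L.IsPrime]

/-- Independent elements at `L` of a uniform module, with a common annihilator, give linearly
independent elements of a pure-injective module in which `R ⧸ L` is pure. -/
theorem IndepOutside.exists_linearIndependent {ι : Type} [Fintype ι] {x : ι → E}
    (hx : IndepOutside L x) (hR : ∀ a b : R, a ∣ b ∨ b ∣ a)
    (hU : ∀ y z : E, y ≠ 0 → z ≠ 0 → ∃ a b : R, a • y = b • z ∧ a • y ≠ 0)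
    (hann : ∀ (i j : ι) (r : R), r • x i = 0 → r • x j = 0) {i₀ j₀ : ι} (hij : i₀ ≠ j₀)
    {H : Type u} [AddCommGroup H] [Module (R ⧸ L) H] (hH : IsPureInjective (R ⧸ L) H)
    {j : (R ⧸ L) →ₗ[R ⧸ L] H} (hj : ReflectsDvd j) :
    ∃ v : ι → H, LinearIndependent (R ⧸ L) v := by
  classical
  have := valuationRing_quotient hR L
  have h1 : (1 : R) ∉ L := (Ideal.ne_top_iff_one L).1 hL.ne_top
  have he : ∀ r ∉ L, r • x j₀ ≠ 0 := fun r => hx.smul_ne_zero j₀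
  have he0 : x j₀ ≠ 0 := by simpa using he 1 h1
  obtain ⟨s, hs, z, hz, hsz⟩ := hx.exists_smul_eq_zero hU hL hij
  have hsu : ¬IsUnit s := fun h => hz (h.smul_eq_zero.1 hsz)
  obtain ⟨C, hC⟩ := exists_submodule_mem_iff_approxMultiple (x := x) (L := L) hR he
  have hπ : ∀ {r : R}, r ∉ L → residueFraction L r ≠ 0 := fun h => residueFraction_eq_zero.not.2 h
  let δ : ι → ι → FractionRing (R ⧸ L) := fun i => Pi.single i 1
  have hδ : ∀ i k, δ i k = residueFraction L (Pi.single (M := fun _ => R) i 1 k) := by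
    intro i k
    by_cases h : k = i
    · subst h; simp [δ]
    · simp [δ, Pi.single_eq_of_ne h]
  have hδC : δ j₀ ∈ C := (hC _).2 ⟨1, h1, Pi.single j₀ 1, fun k => by rw [map_one, one_mul, hδ],
    1, 1, by simp, by simpa using he0⟩
  let k : (R ⧸ L) →ₗ[R ⧸ L] C := LinearMap.toSpanSingleton _ _ ⟨δ j₀, hδC⟩
  have hCT : NoTorsion (R ⧸ L) C := by
    intro a v hav
    by_cases ha : a = 0
    · exact Or.inl ha
    right
    obtain ⟨a, rfl⟩ := Ideal.Quotient.mk_surjective a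
    ext i
    have := congrFun (congrArg Subtype.val hav) i
    change Ideal.Quotient.mk L a • v.1 i = 0 at this
    rw [mk_smul_fraction] at this
    exact (mul_eq_zero.1 this).resolve_left
      (hπ fun h => ha (Ideal.Quotient.eq_zero_iff_mem.2 h))
  have hk : ReflectsDvd k := by
    intro d τ v hdv
    obtain ⟨d, rfl⟩ := Ideal.Quotient.mk_surjective d
    obtain ⟨τ, rfl⟩ := Ideal.Quotient.mk_surjective τ
    rcases hR τ d with ⟨c, rfl⟩ | ⟨t₁, rfl⟩
    · exact ⟨Ideal.Quotient.mk L c, by simp⟩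
    by_cases hd : d ∈ L
    · exact ⟨0, by simpa using Ideal.Quotient.eq_zero_iff_mem.2 hd⟩
    by_cases ht₁ : IsUnit t₁
    · obtain ⟨c, hc⟩ := ht₁.exists_right_inv
      exact ⟨Ideal.Quotient.mk L c, by rw [smul_eq_mul, ← map_mul, mul_assoc, hc, mul_one]⟩
    exfalso
    obtain ⟨t, ht, f, hf, r, m, h2, h3⟩ := (hC _).1 v.2
    have hl : ∀ i, (t • Pi.single j₀ 1 - t₁ • f : ι → R) i ∈ L := by
      intro i
      rw [← residueFraction_eq_zero]
      have h4 := congrFun (congrArg Subtype.val hdv) i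
      change Ideal.Quotient.mk L d • δ j₀ i = Ideal.Quotient.mk L (d * t₁) • v.1 i at h4
      rw [mk_smul_fraction, mk_smul_fraction, map_mul, mul_assoc] at h4
      have h5 := mul_left_cancel₀ (hπ hd) h4
      rw [Pi.sub_apply, Pi.smul_apply, Pi.smul_apply, smul_eq_mul, smul_eq_mul, map_sub, map_mul,
        map_mul, ← hδ, ← hf, h5]
      ring
    choose l hl hl' using fun i => Ideal.exists_eq_mul_of_mem hR hL ht (hl i)
    obtain ⟨u, hu⟩ : IsUnit (1 - t₁ * r) :=
      (IsLocalRing.isUnit_or_isUnit_one_sub_self _).resolve_left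
        fun h => ht₁ (isUnit_of_mul_isUnit_left h)
    have hev : (m * t) • Fintype.linearCombination R x l = (m * t * (u : R)) • x j₀ := by
      rw [mul_smul, ← map_smul, show t • l = t • Pi.single j₀ 1 - t₁ • f from
        funext fun i => (hl' i).symm, map_sub, map_smul, map_smul,
        Fintype.linearCombination_apply_single, one_smul, smul_sub, smul_comm m t₁, h2, smul_smul,
        smul_smul, ← sub_smul, hu]
      ring_nf
    refine h3 (smul_linearCombination_eq_zero_of_forall_mem hR hU hL hann hs hz hsz
      (l := (↑u⁻¹ : R) • l) (fun i => L.mul_mem_left _ (hl i)) ?_)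
    rw [map_smul, smul_comm, hev, smul_smul, mul_left_comm, Units.inv_mul, mul_one]
  obtain ⟨g, hg⟩ := hH _ _ (hk.isPureSubmodule_range hCT)
    (j ∘ₗ (LinearEquiv.ofInjective k hk.injective).symm.toLinearMap)
  have hgk : ∀ d, g (k d) = j d := by
    intro d
    have := hg (LinearEquiv.ofInjective k hk.injective d)
    simpa using this
  have hginj : ∀ v, g v = 0 → v = 0 := by
    intro v hv
    by_contra hv0
    obtain ⟨t, ht, f, hf, -⟩ := (hC _).1 v.2
    obtain ⟨i, hi⟩ : ∃ i, f i ∉ L := by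
      by_contra! hcon
      refine hv0 (Subtype.ext (funext fun i => ?_))
      have := hf i
      rw [residueFraction_eq_zero.2 (hcon i)] at this
      exact (mul_eq_zero.1 this).resolve_left (hπ ht)
    obtain ⟨m, b, q, hq, h2, h3⟩ := exists_smul_sub_eq_zero hR hU hL hx hann j₀ hi
    obtain ⟨t₁, ht₁, ht₁u, r, m', h4, h5⟩ :=
      exists_nonunit_smul_sub_eq_zero hR hU hL he hs hsu hq h2 h3
    have hqt : q * t₁ ∉ L := fun h => (hL.mem_or_mem h).elim hq ht₁
    obtain ⟨w, hw⟩ : ∃ w : C, ∀ i, residueFraction L (q * t₁) * w.1 i =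
        residueFraction L ((q • Pi.single j₀ 1 - b • f : ι → R) i) := by
      refine ⟨⟨fun i => residueFraction L ((q • Pi.single j₀ 1 - b • f : ι → R) i) /
        residueFraction L (q * t₁), (hC _).2 ⟨q * t₁, hqt, q • Pi.single j₀ 1 - b • f,
          fun i => mul_div_cancel₀ _ (hπ hqt), r, m', ?_, h5⟩⟩,
          fun i => mul_div_cancel₀ _ (hπ hqt)⟩
      rw [map_sub, map_smul, map_smul, Fintype.linearCombination_apply_single, one_smul, h4]
    have hkw : k (Ideal.Quotient.mk L q) - Ideal.Quotient.mk L (b * t) • v =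
        Ideal.Quotient.mk L (q * t₁) • w := by
      refine Subtype.ext (funext fun i => ?_)
      change Ideal.Quotient.mk L q • δ j₀ i - Ideal.Quotient.mk L (b * t) • v.1 i =
        Ideal.Quotient.mk L (q * t₁) • w.1 i
      rw [mk_smul_fraction, mk_smul_fraction, mk_smul_fraction, hw, hδ, Pi.sub_apply,
        Pi.smul_apply, Pi.smul_apply, smul_eq_mul, smul_eq_mul, map_sub, map_mul _ q,
        map_mul _ b (f i), ← hf, map_mul _ b t, mul_assoc]
    have hgw := congrArg g hkw
    rw [map_sub, hgk, map_smul, hv, smul_zero, sub_zero, map_smul] at hgw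
    obtain ⟨c, hc⟩ := hj _ _ _ hgw
    obtain ⟨c, rfl⟩ := Ideal.Quotient.mk_surjective c
    rw [smul_eq_mul, ← map_mul, Ideal.Quotient.eq] at hc
    have hu : IsUnit (1 - t₁ * c) := (IsLocalRing.isUnit_or_isUnit_one_sub_self _).resolve_left
      fun h => ht₁u (isUnit_of_mul_isUnit_left h)
    rw [show q - q * t₁ * c = q * (1 - t₁ * c) by ring] at hc
    exact (hL.mem_or_mem hc).elim hq fun h => hL.not_isUnit_of_mem h hu
  obtain ⟨a, b, hab, ha⟩ := hU (x j₀) z he0 hz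
  have hsa : (a * s) • x j₀ = 0 := by
    rw [mul_comm, mul_smul, hab, smul_comm, hsz, smul_zero]
  have hmem : ∀ i, Ideal.Quotient.mk L s • δ i ∈ C := fun i =>
    (hC _).2 ⟨1, h1, s • Pi.single i 1, fun k => by
      rw [Pi.smul_apply, Pi.smul_apply, mk_smul_fraction, hδ, map_one, one_mul, smul_eq_mul,
        map_mul], 0, a, by
      rw [map_smul, Fintype.linearCombination_apply_single, one_smul, smul_smul, hann j₀ i _ hsa]
      simp, by simpa using ha⟩
  refine ⟨fun i => g ⟨_, hmem i⟩, ?_⟩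
  have hli : LinearIndependent (R ⧸ L) fun i => (⟨_, hmem i⟩ : C) := by
    refine LinearIndependent.of_comp C.subtype (Fintype.linearIndependent_iff.2 fun c hc i => ?_)
    obtain ⟨d, hd⟩ := Ideal.Quotient.mk_surjective (c i)
    have h2 := congrFun hc i
    simp only [Function.comp_apply, Submodule.subtype_apply, Finset.sum_apply, Pi.smul_apply] at h2
    rw [Finset.sum_eq_single i (fun k _ hk => by simp [δ, Pi.single_eq_of_ne hk.symm]) (by simp),
      ← hd, mk_smul_fraction, mk_smul_fraction, hδ] at h2
    rw [← hd, Ideal.Quotient.eq_zero_iff_mem, ← residueFraction_eq_zero]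
    simpa [hπ hs] using h2
  exact hli.map' g (LinearMap.ker_eq_bot'.2 hginj)

end UniformLinearIndependence

section UniformCover

variable {R : Type u} [CommRing R] {M : Type u} [AddCommGroup M] [Module R M]

/-- A module of finite Goldie dimension has a finite essential sum of independent cyclic
submodules. -/
theorem HasFiniteGoldieDimension.exists_sSupIndep (hM : HasFiniteGoldieDimension R M) :
    ∃ S : Set (Submodule R M), S.Finite ∧ sSupIndep S ∧
      (∀ N ∈ S, ∃ x : M, x ≠ 0 ∧ N = Submodule.span R {x}) ∧
      ∀ y : M, y ≠ 0 → ∃ r : R, r • y ≠ 0 ∧ r • y ∈ sSup S := by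
  obtain ⟨S, -, hS⟩ := zorn_subset_nonempty
    {S : Set (Submodule R M) | sSupIndep S ∧ ∀ N ∈ S, ∃ x : M, x ≠ 0 ∧ N = Submodule.span R {x}}
    (fun c hc hchain _ => by
      refine ⟨⋃₀ c, ⟨?_, ?_⟩, fun _ => Set.subset_sUnion_of_mem⟩
      · rw [Set.sUnion_eq_iUnion]
        exact sSupIndep_iUnion_of_directed (directedOn_iff_directed.1 hchain.directedOn)
          fun S => (hc S.2).1
      · rintro N ⟨S, hS, hN⟩
        exact (hc hS).2 N hN) ∅
    ⟨sSupIndep_empty, fun _ h => h.elim⟩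
  refine ⟨S, ?_, hS.prop.1, hS.prop.2, fun y hy => ?_⟩
  · have : Finite S := by
      refine hM S (fun N => N.1) (fun N => ?_) fun N => ?_
      · obtain ⟨x, hx, h⟩ := hS.prop.2 N N.2
        rwa [h, Ne, Submodule.span_singleton_eq_bot]
      · rw [← disjoint_iff]
        refine (hS.prop.1 N.2).mono_right (iSup_le fun j => le_sSup ?_)
        exact ⟨j.1.2, fun h => j.2 (Subtype.ext h)⟩
    exact S.toFinite
  by_contra! hcon
  have hdisj : Disjoint (sSup S) (Submodule.span R {y}) := by
    rw [Submodule.disjoint_def]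
    intro z hz hzy
    obtain ⟨r, rfl⟩ := Submodule.mem_span_singleton.1 hzy
    by_contra h
    exact hcon r h hz
  have hmem : Submodule.span R {y} ∈ S := by
    refine hS.le_of_ge ⟨?_, ?_⟩ (Set.subset_insert (Submodule.span R {y}) S)
      (Set.mem_insert _ S)
    · intro N hN
      by_cases hNy : N = Submodule.span R {y}
      · refine (hdisj.symm.mono_left hNy.le).mono_right (sSup_le_sSup ?_)
        rintro N' ⟨hN' | hN', hne⟩
        · exact (hne (hN'.trans hNy.symm)).elim
        · exact hN'
      · have hNS := hN.resolve_left hNy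
        have h1 : sSup (insert (Submodule.span R {y}) S \ {N}) ≤
            sSup (S \ {N}) ⊔ Submodule.span R {y} := by
          refine sSup_le ?_
          rintro N' ⟨hN' | hN', hne⟩
          · exact hN'.le.trans le_sup_right
          · exact (le_sSup (show N' ∈ S \ {N} from ⟨hN', hne⟩)).trans le_sup_left
        refine Disjoint.mono_right h1 ?_
        refine (hS.prop.1 hNS).disjoint_sup_right_of_disjoint_sup_left (hdisj.mono_left ?_)
        exact sup_le (le_sSup hNS) (sSup_le_sSup Set.sdiff_subset)
    · rintro N (rfl | hN)
      · exact ⟨y, hy, rfl⟩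
      · exact hS.prop.2 N hN
  have hy1 : y ∈ Submodule.span R {y} := Submodule.mem_span_singleton_self y
  exact hcon 1 (by simpa using hy) (by simpa using le_sSup hmem hy1)

/-- Over a chain ring a module of finite Goldie dimension embeds in a finite product of uniform
modules. -/
theorem HasFiniteGoldieDimension.exists_uniform_cover (hR : ∀ a b : R, a ∣ b ∨ b ∣ a)
    (hM : HasFiniteGoldieDimension R M) :
    ∃ (I : Type u) (_ : Fintype I) (K : I → Submodule R M),
      (∀ i, ∀ y z : M ⧸ K i, y ≠ 0 → z ≠ 0 → ∃ a b : R, a • y = b • z ∧ a • y ≠ 0) ∧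
      ∀ y, (∀ i, y ∈ K i) → y = 0 := by
  obtain ⟨S, hfin, hind, hcyc, hess⟩ := hM.exists_sSupIndep
  have := hfin.fintype
  have hK : ∀ N : S, ∃ K : Submodule R M, sSup (S \ {N.1}) ≤ K ∧ Disjoint K N.1 ∧
      ∀ K', K ≤ K' → Disjoint K' N.1 → K' = K := fun N =>
    exists_ge_maximal_submodule (fun K => Disjoint K N.1)
      (fun c _ hc hmem _ => by
        rw [Submodule.disjoint_def]
        intro x hx hxN
        obtain ⟨K, hK, hxK⟩ := (hmem x).1 hx
        exact Submodule.disjoint_def.1 (hc K hK) x hxK hxN) _ (hind N.2).symm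
  choose K hle hdisj hmax using hK
  refine ⟨S, this, K, fun N => ?_, fun y hy => ?_⟩
  · have hreach : ∀ y : M, y ∉ K N → ∃ r : R, ∃ n ∈ N.1, n ≠ 0 ∧ r • y - n ∈ K N := by
      intro y hy
      by_contra! hcon
      have hd : Disjoint (K N ⊔ Submodule.span R {y}) N.1 := by
        rw [Submodule.disjoint_def]
        intro n hn hnN
        obtain ⟨k, hk, w, hw, rfl⟩ := Submodule.mem_sup.1 hn
        obtain ⟨r, rfl⟩ := Submodule.mem_span_singleton.1 hw
        by_contra h0
        refine hcon r _ hnN h0 ?_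
        rw [sub_add_cancel_right]
        exact neg_mem hk
      exact hy ((hmax N _ le_sup_left hd) ▸
        Submodule.mem_sup_right (Submodule.mem_span_singleton_self y))
    intro y z hy hz
    obtain ⟨y, rfl⟩ := (K N).mkQ_surjective y
    obtain ⟨z, rfl⟩ := (K N).mkQ_surjective z
    have hmk : ∀ w, (K N).mkQ w = 0 ↔ w ∈ K N := fun w => Submodule.Quotient.mk_eq_zero _
    obtain ⟨r, n, hn, hn0, hrn⟩ := hreach y ((hmk y).not.1 hy)
    obtain ⟨r', n', hn', hn0', hrn'⟩ := hreach z ((hmk z).not.1 hz)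
    have hmain : ∃ a b : R, a • n = b • n' ∧ a • n ≠ 0 := by
      obtain ⟨x, -, hx⟩ := hcyc N.1 N.2
      rw [hx] at hn hn'
      obtain ⟨c, rfl⟩ := Submodule.mem_span_singleton.1 hn
      obtain ⟨d, rfl⟩ := Submodule.mem_span_singleton.1 hn'
      rcases hR c d with ⟨e, rfl⟩ | ⟨e, rfl⟩
      · exact ⟨e, 1, by rw [smul_smul, one_smul, mul_comm], by rwa [smul_smul, mul_comm]⟩
      · exact ⟨1, e, by rw [one_smul, smul_smul, mul_comm], by rwa [one_smul]⟩
    obtain ⟨a, b, hab, ha⟩ := hmain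
    have hy' : (K N).mkQ (r • y) = (K N).mkQ n := by
      rw [← sub_eq_zero, ← map_sub, hmk]; exact hrn
    have hz' : (K N).mkQ (r' • z) = (K N).mkQ n' := by
      rw [← sub_eq_zero, ← map_sub, hmk]; exact hrn'
    have hay : (a * r) • (K N).mkQ y = (K N).mkQ (a • n) := by
      rw [mul_smul, ← map_smul, hy', map_smul]
    refine ⟨a * r, b * r', ?_, ?_⟩
    · rw [hay, hab, mul_smul, ← map_smul, hz', map_smul]
    · rw [hay, Ne, hmk]
      exact fun h => ha (Submodule.disjoint_def.1 (hdisj N) _ h (N.1.smul_mem a hn))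
  · by_contra hy0
    obtain ⟨r, hr0, hr⟩ := hess y hy0
    rw [sSup_eq_iSup', Submodule.mem_iSup_iff_exists_finsupp] at hr
    obtain ⟨f, hf, hfr⟩ := hr
    refine hr0 (hfr.symm.trans (Finset.sum_eq_zero fun N hN => ?_))
    refine Submodule.disjoint_def.1 (hdisj N) _ ?_ (hf N)
    classical
    have h1 : f N = r • y - ∑ N' ∈ f.support.erase N, f N' := by
      rw [← hfr, Finsupp.sum, ← Finset.add_sum_erase _ _ hN, add_sub_cancel_right]
    rw [h1]
    refine sub_mem ((K N).smul_mem r (hy N)) (sum_mem fun N' hN' => hle N ?_)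
    refine le_sSup (show N'.1 ∈ S \ {N.1} from ⟨N'.2, fun h => ?_⟩) (hf N')
    exact Finset.ne_of_mem_erase hN' (Subtype.ext h)

end UniformCover

section Reduction

variable {R : Type*} [CommRing R] {M W : Type*} [AddCommGroup M] [Module R M] [AddCommGroup W]
  [Module R W] {L : Ideal R}

theorem IndepOutside.comp_injective {ι κ : Type*} {x : ι → M}
    (hx : IndepOutside L x) {e : κ → ι} (he : Function.Injective e) : IndepOutside L (x ∘ e) := by
  refine ⟨fun i => hx.1 _, fun c hc i => ?_⟩
  have h := hx.2 (c.mapDomain e) (by rwa [Finsupp.linearCombination_mapDomain]) (e i)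
  rwa [Finsupp.mapDomain_apply he] at h

/-- If `W` has no independent families of size `d`, combinations over blocks of size `d` of an
independent sequence can be chosen to be torsion in `W`. -/
theorem IndepOutside.exists_isTorsionOutside_map (hL : L.IsPrime) {z : ℕ → M}
    (hz : IndepOutside L z) (φ : M →ₗ[R] W) {d : ℕ} (hW : ∀ w : Fin d → W, ¬IndepOutside L w) :
    ∃ z' : ℕ → M, IndepOutside L z' ∧ (∀ n, IsTorsionOutside L (φ (z' n))) ∧
      ∀ n, z' n ∈ Submodule.span R (Set.range z) := by
  classical
  let y : ℕ × Fin d → M := z ∘ fun p => Nat.pair p.1 p.2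
  have hy : IndepOutside L y := hz.comp_injective fun p q h => by
    have := Nat.pair_eq_pair.1 h
    exact Prod.ext this.1 (Fin.ext this.2)
  have hyz : ∀ p, y p ∈ Submodule.span R (Set.range z) := fun p =>
    Submodule.subset_span ⟨_, rfl⟩
  have hblock : ∀ k, ∃ c : Fin d →₀ R,
      ¬IsTorsionOutside L (Finsupp.linearCombination R (fun i => y (k, i)) c) ∧
      IsTorsionOutside L (φ (Finsupp.linearCombination R (fun i => y (k, i)) c)) := by
    intro k
    have hk : IndepOutside L fun i => y (k, i) :=
      hy.comp_injective fun i j h => (Prod.mk.inj h).2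
    by_contra! hcon
    refine hW (fun i => φ (y (k, i))) ⟨fun i h => ?_, fun c hc i => ?_⟩
    · refine hcon (Finsupp.single i 1) ?_ ?_
      · simpa using hk.1 i
      · simpa using h
    · have hφ : φ (Finsupp.linearCombination R (fun i => y (k, i)) c) =
          Finsupp.linearCombination R (fun i => φ (y (k, i))) c := by
        rw [Finsupp.apply_linearCombination]; rfl
      by_contra h
      refine hcon c (fun h' => h ?_) (hφ ▸ hc)
      obtain ⟨s, hs, h0⟩ := hk.2 c h' i
      exact ⟨s, hs, by rw [← map_smul, ← map_smul, h0, map_zero]⟩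
  choose c hc hcφ using hblock
  refine ⟨fun k => Finsupp.linearCombination R (fun i => y (k, i)) (c k), ⟨hc, fun a ha k => ?_⟩,
    hcφ, fun k => ?_⟩
  · let b : ℕ × Fin d →₀ R := Finsupp.onFinset (a.support ×ˢ Finset.univ)
      (fun p => a p.1 * c p.1 p.2) fun p hp => by
        simpa using left_ne_zero_of_mul hp
    have hb : Finsupp.linearCombination R y b = Finsupp.linearCombination R
        (fun k => Finsupp.linearCombination R (fun i => y (k, i)) (c k)) a := by
      rw [Finsupp.linearCombination_apply, Finsupp.onFinset_sum _ (by simp), Finset.sum_product,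
        Finsupp.linearCombination_apply, Finsupp.sum]
      refine Finset.sum_congr rfl fun k _ => ?_
      rw [Finsupp.linearCombination_apply, Finsupp.sum_fintype _ _ (by simp), Finset.smul_sum]
      simp only [mul_smul]
    have h := hy.2 b (hb ▸ ha)
    change IsTorsionOutside L (a k • Finsupp.linearCombination R (fun i => y (k, i)) (c k))
    rw [Finsupp.linearCombination_apply, Finsupp.sum_fintype _ _ (by simp), Finset.smul_sum]
    refine .finset_sum hL fun i _ => ?_
    rw [smul_smul]
    exact h (k, i)
  · change Finsupp.linearCombination R (fun i => y (k, i)) (c k) ∈ _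
    rw [Finsupp.linearCombination_apply]
    exact sum_mem fun i _ => Submodule.smul_mem _ _ (hyz _)

theorem exists_indepOutside_forall_isTorsionOutside (hL : L.IsPrime) {I : Type*} {d : ℕ}
    {K : I → Submodule R M} (hK : ∀ i, ∀ w : Fin d → M ⧸ K i, ¬IndepOutside L w) {z : ℕ → M}
    (hz : IndepOutside L z) (s : Finset I) : ∃ z' : ℕ → M, IndepOutside L z' ∧
      ∀ i ∈ s, ∀ n, IsTorsionOutside L ((K i).mkQ (z' n)) := by
  induction s using Finset.cons_induction with
  | empty => exact ⟨z, hz, by simp⟩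
  | cons i s hi ih =>
    obtain ⟨z', hz', h⟩ := ih
    obtain ⟨z'', hz'', h', hspan⟩ := hz'.exists_isTorsionOutside_map hL (K i).mkQ (hK i)
    refine ⟨z'', hz'', fun j hj n => ?_⟩
    rcases Finset.mem_cons.1 hj with rfl | hj
    · exact h' n
    · refine Submodule.span_induction (p := fun y _ => IsTorsionOutside L ((K j).mkQ y)) ?_ ?_ ?_ ?_
        (hspan n)
      · rintro _ ⟨m, rfl⟩
        exact h j hj m
      · rw [map_zero]
        exact .zero hL
      · intro x y _ _ hx hy
        rw [map_add]
        exact hx.add hL hy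
      · intro a x _ hx
        rw [map_smul]
        exact hx.smul a

/-- An infinite independent family is seen in some module of a finite cover. -/
theorem IndepOutside.exists_quotient (hL : L.IsPrime) {I : Type*} [Fintype I]
    {K : I → Submodule R M} (hK0 : ∀ y, (∀ i, y ∈ K i) → y = 0) {z : ℕ → M}
    (hz : IndepOutside L z) (d : ℕ) : ∃ i, ∃ w : Fin d → M ⧸ K i, IndepOutside L w := by
  by_contra! hcon
  obtain ⟨z', hz', h⟩ := exists_indepOutside_forall_isTorsionOutside hL hcon hz Finset.univ
  choose s hs h using fun i => h i (Finset.mem_univ i) 0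
  refine hz'.1 0 ⟨∏ i, s i, fun hmem => ?_, hK0 _ fun i => ?_⟩
  · obtain ⟨i, -, hi⟩ := (hL.prod_mem_iff).1 hmem
    exact hs i hi
  · rw [← Submodule.Quotient.mk_eq_zero, ← Submodule.mkQ_apply, map_smul]
    classical
    rw [← Finset.prod_erase_mul _ _ (Finset.mem_univ i), mul_smul, h, smul_zero]

/-- Independent elements of a uniform module have multiples with a common annihilator. -/
theorem IndepOutside.exists_common_annihilator (hR : ∀ a b : R, a ∣ b ∨ b ∣ a)
    (hU : ∀ y z : M, y ≠ 0 → z ≠ 0 → ∃ a b : R, a • y = b • z ∧ a • y ≠ 0) (hL : L.IsPrime)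
    {ι : Type*} [Fintype ι] [Nonempty ι] {x : ι → M} (hx : IndepOutside L x) :
    ∃ x' : ι → M, IndepOutside L x' ∧ ∀ (i j : ι) (r : R), r • x' i = 0 → r • x' j = 0 := by
  have hne : ∀ i, x i ≠ 0 := fun i h => hx.1 i (h ▸ .zero hL)
  have htot : ∀ y z : M, y ≠ 0 → z ≠ 0 → (∃ q : R, ∀ r : R, r • y = 0 ↔ r • q • z = 0) ∨
      ∃ q : R, ∀ r : R, r • z = 0 ↔ r • q • y = 0 := by
    have key : ∀ (y z : M) (a q : R), a • y = (a * q) • z → a • y ≠ 0 →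
        ∀ r : R, r • y = 0 ↔ r • q • z = 0 := by
      intro y z a q h h0 r
      rcases hR a r with ⟨n, rfl⟩ | ⟨n, rfl⟩
      · rw [mul_comm, mul_smul, mul_smul, h, mul_smul a]
      · refine iff_of_false (fun hr => h0 ?_) (fun hr => h0 ?_)
        · rw [mul_comm, mul_smul, hr, smul_zero]
        · rw [h, mul_smul, mul_comm, mul_smul, hr, smul_zero]
    intro y z hy hz
    obtain ⟨a, b, hab, ha⟩ := hU y z hy hz
    rcases hR a b with ⟨q, rfl⟩ | ⟨q, rfl⟩
    · exact Or.inl ⟨q, key y z a q hab ha⟩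
    · exact Or.inr ⟨q, key z y b q hab.symm (hab ▸ ha)⟩
  have hmin : ∀ s : Finset ι, s.Nonempty → ∃ j ∈ s, ∀ i ∈ s, ∃ q : R, ∀ r : R,
      r • x j = 0 ↔ r • q • x i = 0 := by
    intro s hs
    induction hs using Finset.Nonempty.cons_induction with
    | singleton a => exact ⟨a, by simp, by simpa using ⟨1, by simp⟩⟩
    | cons a s ha hs ih =>
      obtain ⟨j, hj, h⟩ := ih
      rcases htot (x a) (x j) (hne a) (hne j) with ⟨q, hq⟩ | ⟨q, hq⟩
      · refine ⟨a, by simp, fun i hi => ?_⟩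
        rcases Finset.mem_cons.1 hi with rfl | hi
        · exact ⟨1, by simp⟩
        · obtain ⟨p, hp⟩ := h i hi
          refine ⟨q * p, fun r => ?_⟩
          rw [hq, smul_smul, hp, smul_smul, smul_smul, mul_assoc]
      · refine ⟨j, by simp [hj], fun i hi => ?_⟩
        rcases Finset.mem_cons.1 hi with rfl | hi
        · exact ⟨q, hq⟩
        · exact h i hi
  obtain ⟨j, -, hj⟩ := hmin Finset.univ Finset.univ_nonempty
  choose q hq using fun i => hj i (Finset.mem_univ i)
  refine ⟨fun i => q i • x i, ⟨fun i ⟨s, hs, h⟩ => hx.1 j ⟨s, hs, (hq i s).2 h⟩, fun c hc i => ?_⟩,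
    fun i k r h => (hq k r).1 ((hq i r).2 h)⟩
  have h := hx.isTorsionOutside_smul (f := fun i => c i * q i) (by
    rw [Finsupp.linearCombination_apply, Finsupp.sum_fintype _ _ (by simp)] at hc
    simpa [Fintype.linearCombination_apply, mul_smul] using hc) i
  rwa [mul_smul] at h

end Reduction

section MalcevRankToGoldie

variable {R : Type u} [CommRing R]

theorem MalcevRankLE.card_le_of_linearIndependent {D : Type*} [CommRing D] [Nontrivial D] {H : Type*}
    [AddCommGroup H] [Module D H] {k : ℕ} (hk : MalcevRankLE D H k) {ι : Type*} [Fintype ι]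
    {v : ι → H} (hv : LinearIndependent D v) : Fintype.card ι ≤ k := by
  obtain ⟨s, -, hs, hspan⟩ := hk (Submodule.span D (Set.range v))
    (Submodule.fg_span (Set.finite_range v))
  refine le_trans ?_ hs
  have := linearIndependent_le_span' v hv (s : Set H) fun y hy => by
    rw [hspan]
    exact Submodule.subset_span hy
  simpa using this

/-- Finite Malcev rank of the pure-injective hulls of the domains `R ⧸ L` bounds the Goldie
dimension of localizations. -/
theorem HasFiniteGoldieDimension.localizedModule [IsLocalRing R]
    (hR : ∀ a b : R, a ∣ b ∨ b ∣ a) {L : Ideal R} [hL : L.IsPrime]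
    (hmal : L ≠ ⊥ → ∀ (H : Type u) [AddCommGroup H] [Module (R ⧸ L) H],
      IsPureInjective (R ⧸ L) H → ∀ j : (R ⧸ L) →ₗ[R ⧸ L] H, Function.Injective j →
        IsPureEssentialExtension (R ⧸ L) (LinearMap.range j) → ∃ k, MalcevRankLE (R ⧸ L) H k)
    {M : Type u} [AddCommGroup M] [Module R M] (hM : HasFiniteGoldieDimension R M) :
    HasFiniteGoldieDimension (Localization.AtPrime L) (LocalizedModule L.primeCompl M) := by
  by_contra hcon
  obtain ⟨z, hz⟩ := exists_indepOutside_of_not_hasFiniteGoldieDimension hcon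
  obtain ⟨I, _, K, hU, hK0⟩ := hM.exists_uniform_cover hR
  have hfam : ∀ n : ℕ, 0 < n → ∃ i, ∃ w : Fin n → M ⧸ K i, IndepOutside L w ∧
      ∀ (i j : Fin n) (r : R), r • w i = 0 → r • w j = 0 := by
    intro n hn
    obtain ⟨i, w, hw⟩ := hz.exists_quotient hL hK0 n
    have : Nonempty (Fin n) := ⟨⟨0, hn⟩⟩
    exact ⟨i, hw.exists_common_annihilator hR (hU i) hL⟩
  have hL0 : L ≠ ⊥ := by
    rintro rfl
    obtain ⟨i, w, hw, -⟩ := hfam 2 two_pos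
    obtain ⟨a, b, hab, ha⟩ := hU i (w 0) (w 1) (fun h => hw.1 0 (h ▸ .zero hL))
      (fun h => hw.1 1 (h ▸ .zero hL))
    have ha0 : a ∉ (⊥ : Ideal R) := by
      rintro h
      rw [Ideal.mem_bot] at h
      simp [h] at ha
    have h := hw.isTorsionOutside_smul (f := Pi.single 0 a - Pi.single 1 b) (by
      rw [map_sub, Fintype.linearCombination_apply_single, Fintype.linearCombination_apply_single,
        hab, sub_self]
      exact .zero hL) 0
    exact hw.1 0 (.of_smul hL ha0 (by simpa using h))
  have := valuationRing_quotient hR L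
  obtain ⟨H, _, _, j, hH, hHT, hj, hess⟩ := exists_pureInjectiveHull (noTorsion_quotient L)
  obtain ⟨k, hk⟩ := hmal hL0 H hH j hj.injective (hess.isPureEssentialExtension hj hHT)
  obtain ⟨i, w, hw, hann⟩ := hfam (k + 2) (by lia)
  obtain ⟨v, hv⟩ := hw.exists_linearIndependent hR (hU i) hann
    (i₀ := 0) (j₀ := 1) (by simp) hH hj
  have := hk.card_le_of_linearIndependent hv
  rw [Fintype.card_fin] at this
  lia

end MalcevRankToGoldie

/-- over a chain ring `R`, localization (at primes) preserves finiteness of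
Goldie dimension for all modules iff for every nonzero prime `L` the pure-injective hull of
`R/L`, as an `R/L`-module, has finite Malcev rank (i.e. the total defect `d_R(L)` is finite). -/
theorem stmt19 (R : Type u) [CommRing R] [IsLocalRing R]
    (hchain : ∀ I J : Ideal R, I ≤ J ∨ J ≤ I) :
    (∀ (M : Type u) [AddCommGroup M] [Module R M],
      HasFiniteGoldieDimension R M →
      ∀ (L : Ideal R) (hL : L.IsPrime),
        letI := hL
        HasFiniteGoldieDimension (Localization.AtPrime L)
          (LocalizedModule L.primeCompl M)) ↔
    (∀ L : Ideal R, L.IsPrime → L ≠ ⊥ →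
      ∀ (H : Type u) [AddCommGroup H] [Module (R ⧸ L) H],
        IsPureInjective (R ⧸ L) H →
        ∀ ι : (R ⧸ L) →ₗ[R ⧸ L] H, Function.Injective ι →
          IsPureEssentialExtension (R ⧸ L) (LinearMap.range ι) →
          ∃ k : ℕ, MalcevRankLE (R ⧸ L) H k) := by
  have hR := dvd_total_of_ideal_total hchain
  constructor
  · intro h L hL hL0 H _ _ _ j hj hess
    have := valuationRing_quotient hR L
    obtain ⟨hjr, hje⟩ := hess.dvdEssential (noTorsion_quotient L) hj
    exact exists_malcevRankLE_of_forall_hasFiniteGoldieDimension hR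
      (fun M _ _ hM => h M hM L hL) hL0 hjr hje
  · intro h M _ _ hM L hL
    exact hM.localizedModule hR fun hL0 H _ _ => h L hL hL0 H
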